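/- Let m ∈ ℕ. For every ε > 0 there exists a constant C_ε > 0 such that for every f ∈ C^∞(S³) with ∫_{S³} p e^{3f} dμ_{S³} = 0 for all p ∈ P̊_m, and every smooth extension u of f to 𝔹⁴ satisfying ∂u/∂r = 0 on S³, one has log( (1/(2π²)) ∫_{S³} e^{3(f - f̄)} dμ_{S³} ) ≤ ( 3/(16π² N_m(S³)) + ε ) [ ∫_{𝔹⁴} (Δu)² dx + 2 ∫_{S³} |∇f|²_{S³} dμ_{S³} ] + C_ε, where f̄ = (1/(2π²)) ∫_{S³} f dμ_{S³}. -/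

import Mathlib

open MeasureTheory Metric Filter
open scoped ENNReal RealInnerProductSpace

noncomputable section

abbrev E (n : ℕ) : Type := EuclideanSpace ℝ (Fin n)

/-- The standard surface measure on the unit sphere `S^{n-1}`, as a Borel measure on `ℝⁿ`. -/
def sphMeasure (n : ℕ) : Measure (E n) :=
  Measure.map Subtype.val ((volume : Measure (E n)).toSphere)

/-- `P̊_m` : polynomials of degree at most `m` with zero mean on the sphere. -/
def P0 (n m : ℕ) : Set (MvPolynomial (Fin n) ℝ) :=
  {p | p.totalDegree ≤ m ∧ ∫ x, MvPolynomial.eval (fun i => x i) p ∂(sphMeasure n) = 0}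

/-- `N_m(S^{n-1})` : the smallest `N` for which there are `N` points on the sphere and
nonnegative weights summing to `1` whose weighted sums annihilate every `p ∈ P̊_m`. -/
def Nsph (n m : ℕ) : ℕ :=
  sInf {N : ℕ | ∃ (x : Fin N → E n) (w : Fin N → ℝ),
    (∀ i, x i ∈ Metric.sphere (0 : E n) 1) ∧ (∀ i, 0 ≤ w i) ∧ (∑ i, w i) = 1 ∧
    ∀ p ∈ P0 n m, (∑ i, w i * MvPolynomial.eval (fun j => x i j) p) = 0}

/-- The Euclidean Laplacian `Δu = Σ_i ∂²u/∂x_i²`. -/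
def lap (n : ℕ) (u : E n → ℝ) (x : E n) : ℝ :=
  ∑ i : Fin n, fderiv ℝ (fun y => fderiv ℝ u y (EuclideanSpace.single i 1)) x
    (EuclideanSpace.single i 1)

/-- `|∇f|²_{S^{n-1}}` at a point `x` of the unit sphere: the squared norm of the tangential
gradient, i.e. `‖∇f‖² - ⟨∇f, x⟩²`. -/
def tgradNormSq (n : ℕ) (f : E n → ℝ) (x : E n) : ℝ :=
  ‖gradient f x‖ ^ 2 - (fderiv ℝ f x x) ^ 2

/-! ### Part 1 : the sphere measure and the divergence theorem on the ball -/

lemma integral_sph (G : E 4 → ℝ) :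
    ∫ x, G x ∂(sphMeasure 4) = ∫ x : sphere (0 : E 4) 1, G x ∂((volume : Measure (E 4)).toSphere) := by
  unfold sphMeasure
  exact (MeasurableEmbedding.subtype_coe isClosed_sphere.measurableSet).integral_map _

instance sph_finite : IsFiniteMeasure (sphMeasure 4) := by
  unfold sphMeasure; infer_instance

lemma sph_compl : sphMeasure 4 (sphere (0 : E 4) 1)ᶜ = 0 := by
  unfold sphMeasure
  rw [Measure.map_apply measurable_subtype_coe isClosed_sphere.measurableSet.compl]
  have : (Subtype.val ⁻¹' (sphere (0 : E 4) 1)ᶜ : Set (sphere (0 : E 4) 1)) = ∅ := by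
    ext x; simp
  rw [this]; simp

lemma sph_ae : ∀ᵐ x ∂(sphMeasure 4), x ∈ sphere (0 : E 4) 1 := by
  rw [ae_iff]; exact sph_compl

lemma sph_univ : (sphMeasure 4).real Set.univ = 2 * Real.pi ^ 2 := by
  unfold sphMeasure
  rw [measureReal_def, Measure.map_apply measurable_subtype_coe MeasurableSet.univ, Set.preimage_univ,
    ← measureReal_def, Measure.toSphere_real_apply_univ]
  rw [measureReal_def, InnerProductSpace.volume_ball_of_dim_even (k := 2) (by simp)]
  simp [ENNReal.toReal_ofReal, Real.pi_pos.le]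
  norm_num [Nat.factorial]; ring_nf
  rw [ENNReal.toReal_ofReal (by positivity)]; ring

/-- Polar coordinates. -/
lemma polar_ball (H : E 4 → ℝ) (hH : Continuous H) :
    ∫ x in ball (0 : E 4) 1, H x =
      ∫ w : sphere (0 : E 4) 1, (∫ r in (0:ℝ)..1, r ^ 3 * H (r • (w : E 4)))
        ∂((volume : Measure (E 4)).toSphere) := by
  set μ : Measure (E 4) := volume
  set I : E 4 → ℝ := (ball (0 : E 4) 1).indicator H with hI
  have hint : Integrable I μ := by
    rw [hI, integrable_indicator_iff measurableSet_ball]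
    exact (hH.continuousOn.integrableOn_compact (isCompact_closedBall (0 : E 4) 1)).mono_set
      ball_subset_closedBall
  have hdim : Module.finrank ℝ (E 4) - 1 = 3 := by simp
  have hmp := μ.measurePreserving_homeomorphUnitSphereProd
  rw [hdim] at hmp
  set T := homeomorphUnitSphereProd (E 4)
  have hval : ∀ p, ((T.symm p : ({0}ᶜ : Set (E 4))) : E 4) = (p.2 : ℝ) • (p.1 : E 4) := fun p => rfl
  have hint2 : Integrable (fun x : ({0}ᶜ : Set (E 4)) => I x) (μ.comap (↑)) := by
    have := (integrableOn_iff_comap_subtypeVal (μ := μ) (f := I) (s := ({0}ᶜ : Set (E 4)))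
      (measurableSet_singleton _).compl).1 hint.integrableOn
    exact this
  have hcomp : (fun x : ({0}ᶜ : Set (E 4)) => I x)
      = (fun p : sphere (0 : E 4) 1 × Set.Ioi (0:ℝ) => I ((p.2 : ℝ) • (p.1 : E 4))) ∘ T := by
    funext x
    simp only [Function.comp]
    rw [← hval, T.symm_apply_apply]
  have hint3 : Integrable (fun p : sphere (0 : E 4) 1 × Set.Ioi (0:ℝ) => I ((p.2 : ℝ) • (p.1 : E 4)))
      (μ.toSphere.prod (Measure.volumeIoiPow 3)) := by
    rw [← hmp.integrable_comp_emb T.measurableEmbedding, ← hcomp]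
    exact hint2
  calc ∫ x in ball (0 : E 4) 1, H x = ∫ x, I x ∂μ := by
        rw [hI, integral_indicator measurableSet_ball]
    _ = ∫ x : ({0}ᶜ : Set (E 4)), I x ∂(μ.comap (↑)) := by
        rw [integral_subtype_comap (measurableSet_singleton _).compl I,
          restrict_compl_singleton]
    _ = ∫ p, I ((p.2 : ℝ) • (p.1 : E 4)) ∂(μ.toSphere.prod (Measure.volumeIoiPow 3)) := by
        rw [← hmp.integral_comp T.measurableEmbedding]
        rw [hcomp]; rfl
    _ = ∫ w, ∫ r, I ((r : ℝ) • (w : E 4)) ∂(Measure.volumeIoiPow 3) ∂μ.toSphere :=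
        integral_prod _ hint3
    _ = _ := by
        congr 1
        funext w
        simp only [Measure.volumeIoiPow, ENNReal.ofReal]
        rw [integral_withDensity_eq_integral_smul
          ((measurable_subtype_coe.pow_const _).real_toNNReal),
          integral_subtype_comap measurableSet_Ioi
            fun a : ℝ ↦ Real.toNNReal (a ^ 3) • I (a • (w : E 4))]
        have h1 : ∫ x in Set.Ioi (0:ℝ), (x ^ 3).toNNReal • I (x • (w : E 4))
            = ∫ x in Set.Ioi (0:ℝ), (Set.Ioo (0:ℝ) 1).indicator (fun x => x ^ 3 * H (x • (w : E 4))) x := by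
          refine setIntegral_congr_fun measurableSet_Ioi fun x hx => ?_
          have hx' : (0:ℝ) < x := hx
          have hw : ‖(w : E 4)‖ = 1 := by simpa using w.2
          have hn : ‖x • (w : E 4)‖ = x := by rw [norm_smul, hw, Real.norm_of_nonneg hx'.le, mul_one]
          simp only [NNReal.smul_def, Real.coe_toNNReal _ (pow_nonneg hx'.le 3), hI, smul_eq_mul]
          by_cases hx1 : x < 1
          · rw [Set.indicator_of_mem, Set.indicator_of_mem]
            · exact ⟨hx', hx1⟩
            · rw [mem_ball_zero_iff, hn]; exact hx1
          · rw [Set.indicator_of_notMem, Set.indicator_of_notMem]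
            · simp
            · exact fun h => hx1 h.2
            · rw [mem_ball_zero_iff, hn]; exact hx1
        rw [h1, intervalIntegral.integral_of_le zero_le_one, setIntegral_indicator measurableSet_Ioo,
          Set.inter_eq_self_of_subset_right (fun x hx => hx.1), integral_Ioc_eq_integral_Ioo]

/-- Integrals over the sphere as integrals over the ball. -/
lemma sph_eq_ball (G : E 4 → ℝ) (hG : ContDiff ℝ 1 G) :
    ∫ x, G x ∂(sphMeasure 4) = ∫ x in ball (0 : E 4) 1, (4 * G x + fderiv ℝ G x x) := by
  have hc : Continuous (fun x => fderiv ℝ G x x) :=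
    (hG.continuous_fderiv (by norm_num)).clm_apply continuous_id
  rw [polar_ball (fun x => 4 * G x + fderiv ℝ G x x) ((continuous_const.mul hG.continuous).add hc), integral_sph]
  congr 1
  funext w
  have hd : ∀ r : ℝ, HasDerivAt (fun r : ℝ => r ^ 4 * G (r • (w : E 4)))
      (r ^ 3 * (4 * G (r • (w : E 4)) + fderiv ℝ G (r • (w : E 4)) (r • (w : E 4)))) r := by
    intro r
    have h1 : HasDerivAt (fun r : ℝ => r • (w : E 4)) (w : E 4) r := by
      simpa using (hasDerivAt_id r).smul_const (w : E 4)
    have h2 := ((hG.differentiable (by norm_num)) (r • (w : E 4))).hasFDerivAt.comp_hasDerivAt r h1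
    have h3 := (hasDerivAt_pow 4 r).mul h2
    refine h3.congr_deriv ?_
    rw [map_smul, smul_eq_mul]
    simp only [Function.comp]
    push_cast; ring
  have hcs : Continuous (fun r : ℝ => r • (w : E 4)) := continuous_id.smul continuous_const
  have := intervalIntegral.integral_eq_sub_of_hasDerivAt (a := 0) (b := 1) (fun r _ => hd r)
    (Continuous.intervalIntegrable (by
      have a1 := hG.continuous.comp hcs
      have a2 := hc.comp hcs
      exact (continuous_pow 3).mul ((continuous_const.mul a1).add a2)) _ _)
  rw [this]; simp

/-- bounded derivative of the smooth transition. -/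
lemma transition_bound : ∃ M : ℝ, ∀ s : ℝ, |s * deriv Real.smoothTransition s| ≤ M ∧
    (s ≤ 0 → deriv Real.smoothTransition s = 0) ∧ (1 < s → deriv Real.smoothTransition s = 0) := by
  have hcd : ContDiff ℝ 1 Real.smoothTransition := Real.smoothTransition.contDiff (n := 1)
  have hc : Continuous (deriv Real.smoothTransition) := hcd.continuous_deriv le_rfl
  have h0 : ∀ s, s < 0 → deriv Real.smoothTransition s = 0 := by
    intro s hs
    have : Real.smoothTransition =ᶠ[nhds s] fun _ => 0 := by
      filter_upwards [gt_mem_nhds hs] with x hx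
      exact Real.smoothTransition.zero_of_nonpos hx.le
    rw [this.deriv_eq]; simp
  have hzero : deriv Real.smoothTransition 0 = 0 := by
    apply IsLocalMin.deriv_eq_zero
    filter_upwards with x
    rw [Real.smoothTransition.zero]; exact Real.smoothTransition.nonneg x
  have h1 : ∀ s, 1 < s → deriv Real.smoothTransition s = 0 := by
    intro s hs
    have : Real.smoothTransition =ᶠ[nhds s] fun _ => 1 := by
      filter_upwards [lt_mem_nhds hs] with x hx
      exact Real.smoothTransition.one_of_one_le hx.le
    rw [this.deriv_eq]; simp
  obtain ⟨M, hM⟩ := (isCompact_Icc (a := (0:ℝ)) (b := 1)).exists_bound_of_continuousOn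
    (f := fun s => s * deriv Real.smoothTransition s) (continuous_id.mul hc).continuousOn
  refine ⟨max M 0, fun s => ⟨?_, ?_, h1 s⟩⟩
  · by_cases hs : s < 0
    · rw [h0 s hs]; simp
    by_cases hs1 : 1 < s
    · rw [h1 s hs1]; simp
    exact (hM s ⟨not_lt.1 hs, not_lt.1 hs1⟩).trans (le_max_left _ _)
  · intro hs
    rcases hs.lt_or_eq with h | h
    · exact h0 s h
    · rw [h, hzero]

/-- cut-off functions -/
def cutoff (n : ℕ) (x : E 4) : ℝ := Real.smoothTransition ((n : ℝ) * (1 - ‖x‖ ^ 2))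

lemma cutoff_contDiff (n : ℕ) : ContDiff ℝ 1 (cutoff n) := by
  unfold cutoff
  exact (Real.smoothTransition.contDiff (n := 1)).comp
    (contDiff_const.mul (contDiff_const.sub (contDiff_norm_sq ℝ)))

lemma cutoff_fderiv (n : ℕ) (x w : E 4) : fderiv ℝ (cutoff n) x w =
    deriv Real.smoothTransition ((n : ℝ) * (1 - ‖x‖ ^ 2)) * (-(2 * n * inner ℝ x w)) := by
  have h1 : HasFDerivAt (fun x : E 4 => (n : ℝ) * (1 - ‖x‖ ^ 2))
      ((n : ℝ) • (-(2 • (innerSL ℝ x) : E 4 →L[ℝ] ℝ))) x := by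
    exact ((hasStrictFDerivAt_norm_sq x).hasFDerivAt.const_sub 1).const_mul _
  have h2 : HasDerivAt Real.smoothTransition (deriv Real.smoothTransition ((n : ℝ) * (1 - ‖x‖ ^ 2)))
      ((n : ℝ) * (1 - ‖x‖ ^ 2)) :=
    (((Real.smoothTransition.contDiff (n := 1)).differentiable (by norm_num)) _).hasDerivAt
  have h3 := h2.comp_hasFDerivAt x h1
  have h4 : cutoff n = Real.smoothTransition ∘ fun x : E 4 => (n : ℝ) * (1 - ‖x‖ ^ 2) := rfl
  rw [h4, h3.fderiv]
  simp
  ring_nf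
  simp

lemma cutoff_supp (n : ℕ) : HasCompactSupport (cutoff n) := by
  refine HasCompactSupport.intro (isCompact_closedBall (0 : E 4) 1) fun x hx => ?_
  apply Real.smoothTransition.zero_of_nonpos
  have : 1 < ‖x‖ := by simpa using hx
  have : 1 - ‖x‖ ^ 2 ≤ 0 := by nlinarith
  exact mul_nonpos_of_nonneg_of_nonpos (Nat.cast_nonneg n) this

lemma ibp_cutoff (n : ℕ) (g : E 4 → ℝ) (hg : ContDiff ℝ 1 g) (v : E 4) :
    ∫ x, cutoff n x * fderiv ℝ g x v = - ∫ x, fderiv ℝ (cutoff n) x v * g x := by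
  have hc := cutoff_contDiff n
  have hs := cutoff_supp n
  have c1 : Continuous fun x => fderiv ℝ g x v :=
    (hg.continuous_fderiv (by norm_num)).clm_apply continuous_const
  have c2 : Continuous fun x => fderiv ℝ (cutoff n) x v :=
    (hc.continuous_fderiv (by norm_num)).clm_apply continuous_const
  apply integral_mul_fderiv_eq_neg_fderiv_mul_of_integrable
  · exact (c2.mul hg.continuous).integrable_of_hasCompactSupport
      (HasCompactSupport.mul_right (hs.fderiv_apply ℝ v))
  · exact (hc.continuous.mul c1).integrable_of_hasCompactSupport hs.mul_right
  · exact (hc.continuous.mul hg.continuous).integrable_of_hasCompactSupport hs.mul_right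
  · intro x _; exact hc.differentiable (by norm_num) x
  · intro x _; exact hg.differentiable (by norm_num) x


lemma coord_single (x : E 4) : ∑ i, x i • (EuclideanSpace.single i (1:ℝ) : E 4) = x := by
  ext j; simp [Finset.sum_apply, Pi.single_apply]

lemma clm_coord (L : E 4 →L[ℝ] ℝ) (x : E 4) :
    L x = ∑ i, x i * L (EuclideanSpace.single i (1:ℝ)) := by
  conv_lhs => rw [← coord_single x]
  simp only [map_sum, map_smul, smul_eq_mul]

lemma ibp_radial (n : ℕ) (G : E 4 → ℝ) (hG : ContDiff ℝ 1 G) :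
    ∫ x, cutoff n x * (4 * G x + fderiv ℝ G x x) = - ∫ x, fderiv ℝ (cutoff n) x x * G x := by
  have hc := cutoff_contDiff n
  have hs := cutoff_supp n
  have hco : ∀ i : Fin 4, ContDiff ℝ 1 (fun x : E 4 => x i) := fun i => by fun_prop
  have key : ∀ i : Fin 4, _ := fun i => ibp_cutoff n (fun x => x i * G x) ((hco i).mul hG)
    (EuclideanSpace.single i 1)
  have hd : ∀ (i : Fin 4) (x : E 4), fderiv ℝ (fun x : E 4 => x i * G x) x (EuclideanSpace.single i 1)
      = G x + x i * fderiv ℝ G x (EuclideanSpace.single i 1) := by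
    intro i x
    have h1 : HasFDerivAt (fun x : E 4 => x i) (EuclideanSpace.proj i : E 4 →L[ℝ] ℝ) x :=
      (EuclideanSpace.proj i : E 4 →L[ℝ] ℝ).hasFDerivAt
    rw [(h1.fun_mul (hG.differentiable (by norm_num) x).hasFDerivAt).fderiv]
    simp; ring
  have hsum := Finset.sum_congr (rfl : (Finset.univ : Finset (Fin 4)) = Finset.univ)
    fun i _ => key i
  rw [Finset.sum_neg_distrib, ← integral_finsetSum, ← integral_finsetSum] at hsum
  · convert hsum using 1
    · congr 1; funext x
      simp only [hd]
      rw [clm_coord (fderiv ℝ G x) x, ← Finset.mul_sum, Finset.sum_add_distrib]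
      simp
    · congr 2; funext x
      rw [← Finset.sum_congr rfl fun i _ => mul_assoc _ _ _, ← Finset.sum_mul]
      congr 1
      rw [clm_coord (fderiv ℝ (cutoff n) x) x]
      exact Finset.sum_congr rfl fun i _ => mul_comm _ _
  · intro i _
    exact (((hc.continuous_fderiv (by norm_num)).clm_apply continuous_const).mul
      ((hco i).mul hG).continuous).integrable_of_hasCompactSupport
      (HasCompactSupport.mul_right (hs.fderiv_apply ℝ _))
  · intro i _
    exact (hc.continuous.mul ((((hco i).mul hG).continuous_fderiv (by norm_num)).clm_apply
      continuous_const)).integrable_of_hasCompactSupport hs.mul_right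

/-- The divergence theorem on the unit ball, for one constant direction. -/
lemma gauss_ball (g : E 4 → ℝ) (hg : ContDiff ℝ 1 g) (v : E 4) :
    ∫ x in ball (0 : E 4) 1, fderiv ℝ g x v = ∫ x, g x * inner ℝ x v ∂(sphMeasure 4) := by
  have hiv : ContDiff ℝ 1 (fun x : E 4 => (inner ℝ x v : ℝ)) := contDiff_id.inner ℝ contDiff_const
  set G : E 4 → ℝ := fun x => g x * inner ℝ x v with hGdef
  have hG : ContDiff ℝ 1 G := hg.mul hiv
  have c1 : Continuous fun x => fderiv ℝ g x v :=
    (hg.continuous_fderiv (by norm_num)).clm_apply continuous_const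
  have c2 : Continuous fun x => 4 * G x + fderiv ℝ G x x :=
    (continuous_const.mul hG.continuous).add
      ((hG.continuous_fderiv (by norm_num)).clm_apply continuous_id)
  have ion : ∀ H : E 4 → ℝ, Continuous H → IntegrableOn H (ball (0 : E 4) 1) := fun H hH =>
    (hH.continuousOn.integrableOn_compact (isCompact_closedBall (0 : E 4) 1)).mono_set
      ball_subset_closedBall
  rw [sph_eq_ball G hG, ← sub_eq_zero, ← integral_sub (ion _ c1) (ion _ c2)]
  set H : E 4 → ℝ := fun x => fderiv ℝ g x v - (4 * G x + fderiv ℝ G x x) with hH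
  have cH : Continuous H := c1.sub c2
  obtain ⟨M, hM⟩ := transition_bound
  set θ : ℝ → ℝ := fun s => s * deriv Real.smoothTransition s with hθ
  -- the identity for each n
  have key : ∀ n : ℕ, ∫ x in ball (0 : E 4) 1, cutoff n x * H x
      = ∫ x in ball (0 : E 4) 1, 2 * G x * θ ((n : ℝ) * (1 - ‖x‖ ^ 2)) := by
    intro n
    have hc := cutoff_contDiff n
    have hs := cutoff_supp n
    have hout : ∀ x : E 4, x ∉ ball (0 : E 4) 1 → (n : ℝ) * (1 - ‖x‖ ^ 2) ≤ 0 := by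
      intro x hx
      have : 1 ≤ ‖x‖ := by simpa using hx
      exact mul_nonpos_of_nonneg_of_nonpos (Nat.cast_nonneg n) (by nlinarith)
    rw [setIntegral_eq_integral_of_forall_compl_eq_zero, setIntegral_eq_integral_of_forall_compl_eq_zero]
    · have e1 : ∀ x, cutoff n x * H x = cutoff n x * fderiv ℝ g x v
          - cutoff n x * (4 * G x + fderiv ℝ G x x) := fun x => by rw [hH]; ring
      have i1 : Integrable (fun x => fderiv ℝ (cutoff n) x v * g x) :=
        (((hc.continuous_fderiv (by norm_num)).clm_apply continuous_const).mul
          hg.continuous).integrable_of_hasCompactSupport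
          (HasCompactSupport.mul_right (hs.fderiv_apply ℝ _))
      have i2 : Integrable (fun x => fderiv ℝ (cutoff n) x x * G x) := by
        refine (((hc.continuous_fderiv (by norm_num)).clm_apply continuous_id).mul
          hG.continuous).integrable_of_hasCompactSupport ?_
        refine HasCompactSupport.intro (isCompact_closedBall (0 : E 4) 1) fun x hx => ?_
        have : x ∉ ball (0 : E 4) 1 := fun h => hx (ball_subset_closedBall h)
        simp only [Pi.mul_apply, id]
        rw [cutoff_fderiv, (hM _).2.1 (hout x this)]; simp
      have i3 : Integrable (fun x => cutoff n x * fderiv ℝ g x v) :=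
        (hc.continuous.mul c1).integrable_of_hasCompactSupport hs.mul_right
      have i4 : Integrable (fun x => cutoff n x * (4 * G x + fderiv ℝ G x x)) :=
        (hc.continuous.mul c2).integrable_of_hasCompactSupport hs.mul_right
      rw [integral_congr_ae (Eventually.of_forall e1), integral_sub i3 i4,
        ibp_cutoff n g hg v, ibp_radial n G hG, sub_neg_eq_add, neg_add_eq_sub,
        ← integral_sub i2 i1]
      congr 1; funext x
      rw [cutoff_fderiv, cutoff_fderiv, hGdef, hθ]
      simp only [real_inner_self_eq_norm_sq]
      ring
    · intro x hx
      simp only [hθ]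
      rw [(hM _).2.1 (hout x hx)]; simp
    · intro x hx
      have : cutoff n x = 0 := Real.smoothTransition.zero_of_nonpos (hout x hx)
      rw [this, zero_mul]
  have htend : ∀ x ∈ ball (0 : E 4) 1, ∀ᶠ n : ℕ in atTop, 1 < (n : ℝ) * (1 - ‖x‖ ^ 2) := by
    intro x hx
    have hx1 : ‖x‖ < 1 := by simpa using hx
    have : 0 < 1 - ‖x‖ ^ 2 := by nlinarith [norm_nonneg x]
    have := (tendsto_natCast_atTop_atTop (R := ℝ)).atTop_mul_const this
    exact this.eventually_gt_atTop 1
  have l1 : Tendsto (fun n : ℕ => ∫ x in ball (0 : E 4) 1, cutoff n x * H x) atTop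
      (nhds (∫ x in ball (0 : E 4) 1, H x)) := by
    refine tendsto_integral_of_dominated_convergence (fun x => ‖H x‖) ?_ (ion H cH).norm ?_ ?_
    · intro n
      exact ((cutoff_contDiff n).continuous.mul cH).aestronglyMeasurable
    · intro n
      filter_upwards with x
      rw [norm_mul]
      refine mul_le_of_le_one_left (norm_nonneg _) ?_
      rw [cutoff, Real.norm_of_nonneg (Real.smoothTransition.nonneg _)]
      exact Real.smoothTransition.le_one _
    · filter_upwards [ae_restrict_mem measurableSet_ball] with x hx
      refine tendsto_const_nhds.congr' ?_
      filter_upwards [htend x hx] with n hn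
      have : cutoff n x = 1 := Real.smoothTransition.one_of_one_le hn.le
      rw [this, one_mul]
  have l2 : Tendsto (fun n : ℕ => ∫ x in ball (0 : E 4) 1, 2 * G x * θ ((n : ℝ) * (1 - ‖x‖ ^ 2))) atTop
      (nhds (∫ x in ball (0 : E 4) 1, (0:ℝ))) := by
    have cθ : Continuous θ := continuous_id.mul
      ((Real.smoothTransition.contDiff (n := 1)).continuous_deriv le_rfl)
    refine tendsto_integral_of_dominated_convergence (fun x => ‖2 * G x‖ * M) ?_
      ((ion _ (continuous_const.mul hG.continuous)).norm.mul_const M) ?_ ?_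
    · intro n
      refine Continuous.aestronglyMeasurable ?_
      exact (continuous_const.mul hG.continuous).mul (cθ.comp (by fun_prop))
    · intro n
      filter_upwards with x
      rw [norm_mul]
      exact mul_le_mul_of_nonneg_left (hM _).1 (norm_nonneg _)
    · filter_upwards [ae_restrict_mem measurableSet_ball] with x hx
      refine tendsto_const_nhds.congr' ?_
      filter_upwards [htend x hx] with n hn
      simp only [hθ]
      rw [(hM _).2.2 hn]; simp
  have := tendsto_nhds_unique l1 (l2.congr fun n => (key n).symm)
  rw [this]; simp

/-- Divergence theorem for functions defined on a larger ball. -/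
lemma extend_fn {t : ℝ} (ht : 1 < t) {n : ℕ∞} (g : E 4 → ℝ) (hg : ContDiffOn ℝ n g (ball 0 t)) :
    ∃ g' : E 4 → ℝ, ContDiff ℝ n g' ∧ ∀ x ∈ closedBall (0 : E 4) 1, g' =ᶠ[nhds x] g := by
  let χ : ContDiffBump (0 : E 4) := ⟨1 + (t - 1) / 3, 1 + 2 * (t - 1) / 3, by linarith, by linarith⟩
  refine ⟨fun x => χ x * g x, ?_, ?_⟩
  · rw [contDiff_iff_contDiffAt]
    intro x
    by_cases hx : x ∈ ball (0 : E 4) t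
    · exact χ.contDiff.contDiffAt.mul (hg.contDiffAt (isOpen_ball.mem_nhds hx))
    · have : (fun x => χ x * g x) =ᶠ[nhds x] fun _ => 0 := by
        have hx2 : x ∈ (closedBall (0 : E 4) χ.rOut)ᶜ := by
          intro h
          apply hx
          have h1 : ‖x‖ ≤ 1 + 2 * (t - 1) / 3 := by simpa using h
          rw [mem_ball_zero_iff]; linarith
        filter_upwards [isClosed_closedBall.isOpen_compl.mem_nhds hx2] with z hz
        rw [χ.zero_of_le_dist, zero_mul]
        rw [Set.mem_compl_iff, mem_closedBall, not_le] at hz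
        exact hz.le
      exact contDiffAt_const.congr_of_eventuallyEq this
  · intro x hx
    have hx1 : x ∈ ball (0 : E 4) χ.rIn := by
      have h1 : ‖x‖ ≤ 1 := by simpa using hx
      rw [mem_ball_zero_iff]; show ‖x‖ < 1 + (t - 1) / 3; linarith
    filter_upwards [isOpen_ball.mem_nhds hx1] with z hz
    rw [χ.one_of_mem_closedBall (ball_subset_closedBall hz), one_mul]

lemma gauss_ball' {t : ℝ} (ht : 1 < t) (g : E 4 → ℝ) (hg : ContDiffOn ℝ 1 g (ball 0 t)) (v : E 4) :
    ∫ x in ball (0 : E 4) 1, fderiv ℝ g x v = ∫ x, g x * inner ℝ x v ∂(sphMeasure 4) := by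
  obtain ⟨g', hg', he⟩ := extend_fn ht (n := 1) g hg
  have := gauss_ball g' hg' v
  have e1 : ∫ x in ball (0 : E 4) 1, fderiv ℝ g x v = ∫ x in ball (0 : E 4) 1, fderiv ℝ g' x v := by
    refine setIntegral_congr_fun measurableSet_ball fun x hx => ?_
    rw [(he x (ball_subset_closedBall hx)).fderiv_eq]
  have e2 : ∫ x, g x * inner ℝ x v ∂(sphMeasure 4) = ∫ x, g' x * inner ℝ x v ∂(sphMeasure 4) := by
    refine integral_congr_ae ?_
    filter_upwards [sph_ae] with x hx
    rw [(he x (sphere_subset_closedBall hx)).self_of_nhds]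
  rw [e1, e2, this]

/-! ### Part 2 : the Green identity -/

lemma int_ball {H : E 4 → ℝ} (h : ContinuousOn H (closedBall (0 : E 4) 1)) :
    IntegrableOn H (ball (0 : E 4) 1) :=
  (h.integrableOn_compact (isCompact_closedBall (0 : E 4) 1)).mono_set ball_subset_closedBall

lemma sph_restrict : (sphMeasure 4).restrict (sphere (0 : E 4) 1) = sphMeasure 4 :=
  Measure.restrict_eq_self_of_ae_mem sph_ae

lemma int_sph {H : E 4 → ℝ} (h : ContinuousOn H (sphere (0 : E 4) 1)) :
    Integrable H (sphMeasure 4) := by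
  have := h.integrableOn_compact (μ := sphMeasure 4) (isCompact_sphere (0 : E 4) 1)
  rwa [IntegrableOn, sph_restrict] at this

lemma closedBall_sub {t : ℝ} (ht : 1 < t) : closedBall (0 : E 4) 1 ⊆ ball 0 t :=
  closedBall_subset_ball ht

lemma sphere_sub {t : ℝ} (ht : 1 < t) : sphere (0 : E 4) 1 ⊆ ball 0 t :=
  sphere_subset_closedBall.trans (closedBall_sub ht)

lemma fderiv_dir_contDiffOn {t : ℝ} {g : E 4 → ℝ} (hg : ContDiffOn ℝ 2 g (ball 0 t)) (v : E 4) :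
    ContDiffOn ℝ 1 (fun x => fderiv ℝ g x v) (ball 0 t) :=
  (hg.fderiv_of_isOpen isOpen_ball (m := 1) (by norm_num)).clm_apply contDiffOn_const

lemma fderiv_self_continuousOn {t : ℝ} {g : E 4 → ℝ} (hg : ContDiffOn ℝ 2 g (ball 0 t)) :
    ContinuousOn (fun x => fderiv ℝ g x x) (ball 0 t) :=
  (hg.fderiv_of_isOpen isOpen_ball (m := 1) (by norm_num)).continuousOn.clm_apply continuousOn_id

lemma diffAt {t : ℝ} {g : E 4 → ℝ} (hg : ContDiffOn ℝ 2 g (ball 0 t)) {x : E 4} (hx : x ∈ ball 0 t) :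
    DifferentiableAt ℝ g x :=
  (hg.contDiffAt (isOpen_ball.mem_nhds hx)).differentiableAt (by norm_num)

lemma snd_symm {t : ℝ} {g : E 4 → ℝ} (hg : ContDiffOn ℝ 2 g (ball 0 t)) {x : E 4} (hx : x ∈ ball 0 t)
    (v w : E 4) : fderiv ℝ (fun z => fderiv ℝ g z w) x v = fderiv ℝ (fun z => fderiv ℝ g z v) x w := by
  have hx' := hg.contDiffAt (isOpen_ball.mem_nhds hx)
  have hsym := hx'.isSymmSndFDerivAt (by simp)
  have hd : DifferentiableAt ℝ (fderiv ℝ g) x :=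
    (hx'.fderiv_right (m := 1) (by norm_num)).differentiableAt (by norm_num)
  rw [fderiv_clm_apply hd (by fun_prop), fderiv_clm_apply hd (by fun_prop)]
  simp
  exact hsym v w

/-- Angular derivatives integrate to zero on the sphere. -/
lemma rot_sph {t : ℝ} (ht : 1 < t) {g : E 4 → ℝ} (hg : ContDiffOn ℝ 2 g (ball 0 t)) (v w : E 4) :
    ∫ x, fderiv ℝ g x w * inner ℝ x v ∂(sphMeasure 4)
      = ∫ x, fderiv ℝ g x v * inner ℝ x w ∂(sphMeasure 4) := by
  rw [← gauss_ball' ht _ (fderiv_dir_contDiffOn hg w), ← gauss_ball' ht _ (fderiv_dir_contDiffOn hg v)]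
  refine setIntegral_congr_fun measurableSet_ball fun x hx => ?_
  exact snd_symm hg (ball_subset_ball ht.le hx) v w

lemma coord_contDiff (i : Fin 4) (n : WithTop ℕ∞) : ContDiff ℝ n (fun x : E 4 => x i) := by fun_prop

lemma coord_hasFDeriv (i : Fin 4) (x : E 4) :
    HasFDerivAt (fun x : E 4 => x i) (EuclideanSpace.proj i : E 4 →L[ℝ] ℝ) x :=
  (EuclideanSpace.proj i : E 4 →L[ℝ] ℝ).hasFDerivAt

lemma inner_coord (x y : E 4) : (inner ℝ x y : ℝ) = ∑ i, x i * y i := by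
  rw [PiLp.inner_apply]; simp [mul_comm]

lemma norm_sq_coord (x : E 4) : ‖x‖ ^ 2 = ∑ i, x i * x i := by
  rw [← real_inner_self_eq_norm_sq, inner_coord]

lemma inner_sgl (x : E 4) (j : Fin 4) : (inner ℝ x (EuclideanSpace.single j (1:ℝ)) : ℝ) = x j := by
  rw [inner_coord]; simp [Pi.single_apply]

/-- Tangential divergence theorem on the sphere. -/
lemma tang_sph {t : ℝ} (ht : 1 < t) {g : E 4 → ℝ} (hg : ContDiffOn ℝ 2 g (ball 0 t)) (y : E 4) :
    ∫ x, (fderiv ℝ g x y - inner ℝ x y * fderiv ℝ g x x) ∂(sphMeasure 4)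
      = ∫ x, 3 * inner ℝ x y * g x ∂(sphMeasure 4) := by
  have hgj : ∀ j : Fin 4, ContDiffOn ℝ 2 (fun x : E 4 => x j * g x) (ball 0 t) := fun j =>
    (coord_contDiff j 2).contDiffOn.mul hg
  have key := fun j : Fin 4 => rot_sph ht (hgj j) (EuclideanSpace.single j 1) y
  have hsum := Finset.sum_congr (rfl : (Finset.univ : Finset (Fin 4)) = Finset.univ)
    fun j _ => key j
  have hci : ∀ w : E 4, ContinuousOn (fun x : E 4 => (inner ℝ x w : ℝ)) (sphere (0 : E 4) 1) := fun w =>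
    (continuous_id.inner continuous_const).continuousOn
  have hcd : ∀ w : E 4, ContinuousOn (fun x : E 4 => fderiv ℝ g x w) (sphere (0 : E 4) 1) := fun w =>
    (fderiv_dir_contDiffOn hg w).continuousOn.mono (sphere_sub ht)
  have hcd' : ContinuousOn (fun x : E 4 => fderiv ℝ g x x) (sphere (0 : E 4) 1) :=
    (fderiv_self_continuousOn hg).mono (sphere_sub ht)
  have hcg : ContinuousOn g (sphere (0 : E 4) 1) := hg.continuousOn.mono (sphere_sub ht)
  have hi : ∀ (j : Fin 4) (v w : E 4), Integrable
      (fun x => fderiv ℝ (fun x : E 4 => x j * g x) x v * inner ℝ x w) (sphMeasure 4) := by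
    intro j v w
    exact int_sph (((fderiv_dir_contDiffOn (hgj j) v).continuousOn.mono (sphere_sub ht)).mul (hci w))
  have hd : ∀ (j : Fin 4) (x : E 4), x ∈ sphere (0 : E 4) 1 → ∀ v, 
      fderiv ℝ (fun x : E 4 => x j * g x) x v = v j * g x + x j * fderiv ℝ g x v := by
    intro j x hx v
    rw [((coord_hasFDeriv j x).fun_mul (diffAt hg (sphere_sub ht hx)).hasFDerivAt).fderiv]
    simp; ring
  rw [← integral_finsetSum _ (fun j _ => hi j _ _), ← integral_finsetSum _ (fun j _ => hi j _ _)] at hsum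
  have e1 : ∫ x, ∑ j, fderiv ℝ (fun x : E 4 => x j * g x) x y * inner ℝ x (EuclideanSpace.single j (1:ℝ))
      ∂(sphMeasure 4) = ∫ x, (inner ℝ x y * g x + fderiv ℝ g x y) ∂(sphMeasure 4) := by
    refine integral_congr_ae ?_
    filter_upwards [sph_ae] with x hx
    have hn : ∑ j, x j * x j = 1 := by
      rw [← norm_sq_coord, mem_sphere_zero_iff_norm.1 hx]; norm_num
    rw [inner_coord x y]
    calc _ = ∑ j, (x j * y j * g x + x j * x j * fderiv ℝ g x y) := by
          refine Finset.sum_congr rfl fun j _ => ?_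
          rw [hd j x hx, inner_sgl]; ring
      _ = _ := by rw [Finset.sum_add_distrib, ← Finset.sum_mul, ← Finset.sum_mul, hn, one_mul]
  have e2 : ∫ x, ∑ j, fderiv ℝ (fun x : E 4 => x j * g x) x (EuclideanSpace.single j (1:ℝ)) * inner ℝ x y
      ∂(sphMeasure 4) = ∫ x, (4 * g x + fderiv ℝ g x x) * inner ℝ x y ∂(sphMeasure 4) := by
    refine integral_congr_ae ?_
    filter_upwards [sph_ae] with x hx
    rw [← Finset.sum_mul]
    congr 1
    rw [clm_coord (fderiv ℝ g x) x]
    simp only [hd _ x hx, Finset.sum_add_distrib]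
    simp
  rw [e1, e2] at hsum
  rw [← sub_eq_zero, ← integral_sub ?_ ?_]
  · rw [← sub_eq_zero, ← integral_sub ?_ ?_] at hsum
    · rw [← hsum]
      congr 1; funext x; ring
    · exact int_sph (((hci y).mul hcg).add (hcd y))
    · exact int_sph (((continuousOn_const.mul hcg).add hcd').mul (hci y))
  · exact int_sph ((hcd y).sub ((hci y).mul hcd'))
  · exact int_sph ((continuousOn_const.mul (hci y)).mul hcg)

/-- squared distance to the exterior pole `t • y`. -/
def sK (t : ℝ) (y x : E 4) : ℝ := ‖x - t • y‖ ^ 2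

/-- the inverse squared distance, harmonic in `ℝ⁴`. -/
def hK (t : ℝ) (y x : E 4) : ℝ := (sK t y x)⁻¹

lemma sK_lower {t : ℝ} (ht : 1 < t) {y x : E 4} (hy : ‖y‖ = 1) (hx : ‖x‖ ≤ t) :
    (t - ‖x‖) ^ 2 ≤ sK t y x := by
  unfold sK
  have h1 : ‖t • y‖ = t := by rw [norm_smul, hy, Real.norm_of_nonneg (by linarith), mul_one]
  have h2 : t - ‖x‖ ≤ ‖x - t • y‖ := by
    have := norm_sub_norm_le (t • y) x
    rwa [h1, norm_sub_rev] at this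
  have : 0 ≤ t - ‖x‖ := by linarith
  gcongr

lemma sK_pos {t : ℝ} (ht : 1 < t) {y x : E 4} (hy : ‖y‖ = 1) (hx : x ∈ ball (0 : E 4) t) :
    0 < sK t y x := by
  have : ‖x‖ < t := by simpa using hx
  exact lt_of_lt_of_le (by have : 0 < t - ‖x‖ := by linarith
                           positivity) (sK_lower ht hy this.le)

lemma sK_contDiff (t : ℝ) (y : E 4) (n : WithTop ℕ∞) : ContDiff ℝ n (sK t y) := by
  unfold sK
  exact (contDiff_norm_sq ℝ).comp (contDiff_id.sub contDiff_const)

lemma hK_contDiffOn {t : ℝ} (ht : 1 < t) {y : E 4} (hy : ‖y‖ = 1) (n : WithTop ℕ∞) :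
    ContDiffOn ℝ n (hK t y) (ball 0 t) := by
  unfold hK
  exact (sK_contDiff t y n).contDiffOn.inv fun x hx => (sK_pos ht hy hx).ne'

lemma sK_hasFDeriv (t : ℝ) (y x : E 4) :
    HasFDerivAt (sK t y) ((2:ℝ) • (innerSL ℝ (x - t • y) : E 4 →L[ℝ] ℝ)) x := by
  have h1 : HasFDerivAt (fun x : E 4 => x - t • y) (ContinuousLinearMap.id ℝ (E 4)) x :=
    (hasFDerivAt_id x).sub_const _
  have h2 := (hasStrictFDerivAt_norm_sq (x - t • y)).hasFDerivAt.comp x h1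
  have h3 : sK t y = (fun x : E 4 => ‖x‖ ^ 2) ∘ (fun x : E 4 => x - t • y) := rfl
  rw [h3]
  refine h2.congr_fderiv ?_
  ext v; simp

lemma hK_hasFDeriv {t : ℝ} (ht : 1 < t) {y x : E 4} (hy : ‖y‖ = 1) (hx : x ∈ ball (0 : E 4) t) :
    HasFDerivAt (hK t y) ((-2 * hK t y x ^ 2) • (innerSL ℝ (x - t • y) : E 4 →L[ℝ] ℝ)) x := by
  have h0 := (sK_pos ht hy hx).ne'
  have h1 := (hasDerivAt_inv h0).comp_hasFDerivAt x (sK_hasFDeriv t y x)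
  have h3 : hK t y = (fun z : ℝ => z⁻¹) ∘ sK t y := rfl
  rw [h3]
  refine h1.congr_fderiv ?_
  ext v; simp [Function.comp]; ring

lemma hK_fderiv {t : ℝ} (ht : 1 < t) {y x : E 4} (hy : ‖y‖ = 1) (hx : x ∈ ball (0 : E 4) t) (v : E 4) :
    fderiv ℝ (hK t y) x v = -2 * hK t y x ^ 2 * inner ℝ (x - t • y) v := by
  rw [(hK_hasFDeriv ht hy hx).fderiv]; rfl

/-! ### Part 3 : the Green identity with the exterior kernel -/

lemma qK_hasFDeriv {t : ℝ} (ht : 1 < t) {y x : E 4} (hy : ‖y‖ = 1) (hx : x ∈ ball (0 : E 4) t)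
    (i : Fin 4) :
    fderiv ℝ (fun x : E 4 => -2 * (x i - t * y i) * hK t y x ^ 2) x (EuclideanSpace.single i 1)
      = -2 * hK t y x ^ 2 + 8 * (x i - t * y i) ^ 2 * hK t y x ^ 3 := by
  have h1 := (((coord_hasFDeriv i x).sub_const (t * y i)).const_mul (-2)).fun_mul
    ((hK_hasFDeriv ht hy hx).pow 2)
  rw [h1.fderiv]
  have h2 : (inner ℝ (x - t • y) (EuclideanSpace.single i (1:ℝ)) : ℝ) = x i - t * y i := by
    rw [inner_sgl]; simp
  simp only [_root_.add_apply, _root_.smul_apply, innerSL_apply_apply, h2]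
  simp
  ring

lemma hK_mul_sK {t : ℝ} (ht : 1 < t) {y x : E 4} (hy : ‖y‖ = 1) (hx : x ∈ ball (0 : E 4) t) :
    hK t y x * sK t y x = 1 := inv_mul_cancel₀ (sK_pos ht hy hx).ne'

lemma green1 {t : ℝ} (ht : 1 < t) {y : E 4} (hy : ‖y‖ = 1) {u : E 4 → ℝ}
    (hu : ContDiffOn ℝ 2 u (ball 0 t)) :
    ∫ x in ball (0 : E 4) 1, lap 4 u x * (2 - 2 * hK t y x)
      = ∫ x, (fderiv ℝ u x x * (2 - 2 * hK t y x)
          - 4 * u x * (1 - t * inner ℝ x y) * hK t y x ^ 2) ∂(sphMeasure 4) := by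
  set w : Fin 4 → E 4 → ℝ := fun i x =>
    (2 - 2 * hK t y x) * fderiv ℝ u x (EuclideanSpace.single i 1)
      + 2 * u x * (-2 * (x i - t * y i) * hK t y x ^ 2) with hw
  have hq : ∀ i : Fin 4, ContDiffOn ℝ 1 (fun x : E 4 => -2 * (x i - t * y i) * hK t y x ^ 2) (ball 0 t) := by
    intro i
    exact (contDiffOn_const.mul ((coord_contDiff i 1).contDiffOn.sub contDiffOn_const)).mul
      ((hK_contDiffOn ht hy 1).pow 2)
  have hwc : ∀ i, ContDiffOn ℝ 1 (w i) (ball 0 t) := by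
    intro i
    exact ((contDiffOn_const.sub (contDiffOn_const.mul (hK_contDiffOn ht hy 1))).mul
      (fderiv_dir_contDiffOn hu _)).add ((contDiffOn_const.mul (hu.of_le (by norm_num))).mul (hq i))
  have key := Finset.sum_congr (rfl : (Finset.univ : Finset (Fin 4)) = Finset.univ)
    fun i _ => gauss_ball' ht (w i) (hwc i) (EuclideanSpace.single i 1)
  rw [← integral_finsetSum, ← integral_finsetSum] at key
  · refine Eq.trans ?_ (key.trans ?_)
    · refine setIntegral_congr_fun measurableSet_ball fun x hx => ?_
      have hx' : x ∈ ball (0 : E 4) t := ball_subset_ball ht.le hx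
      have hd : ∀ i, fderiv ℝ (w i) x (EuclideanSpace.single i 1) =
          (2 - 2 * hK t y x) * fderiv ℝ (fun z => fderiv ℝ u z (EuclideanSpace.single i 1)) x (EuclideanSpace.single i 1)
          + 2 * u x * (-2 * hK t y x ^ 2 + 8 * (x i - t * y i) ^ 2 * hK t y x ^ 3) := by
        intro i
        have d1 := (hK_hasFDeriv ht hy hx').const_mul 2 |>.const_sub 2
        have d2 : HasFDerivAt (fun z => fderiv ℝ u z (EuclideanSpace.single i 1)) _ x :=
          (((fderiv_dir_contDiffOn hu (EuclideanSpace.single i 1)).contDiffAt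
            (isOpen_ball.mem_nhds hx')).differentiableAt (by norm_num)).hasFDerivAt
        have d3 := (diffAt hu hx').hasFDerivAt.const_mul 2
        have d4 : HasFDerivAt (fun x : E 4 => -2 * (x i - t * y i) * hK t y x ^ 2) _ x :=
          (((hq i).contDiffAt
            (isOpen_ball.mem_nhds hx')).differentiableAt (by norm_num)).hasFDerivAt
        have h2 : (inner ℝ (x - t • y) (EuclideanSpace.single i (1:ℝ)) : ℝ) = x i - t * y i := by
          rw [inner_sgl]; simp
        rw [((d1.fun_mul d2).fun_add (d3.fun_mul d4)).fderiv]
        simp only [_root_.add_apply, _root_.smul_apply, innerSL_apply_apply, h2,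
          _root_.neg_apply, qK_hasFDeriv ht hy hx', smul_eq_mul]
        ring
      simp only [hd]
      rw [Finset.sum_add_distrib, ← Finset.mul_sum, ← Finset.mul_sum, Finset.sum_add_distrib]
      have hs : ∑ i, 8 * (x i - t * y i) ^ 2 * hK t y x ^ 3 = 8 * sK t y x * hK t y x ^ 3 := by
        rw [← Finset.sum_mul, ← Finset.mul_sum]
        congr 2
        rw [sK, norm_sq_coord]
        refine Finset.sum_congr rfl fun i _ => ?_
        simp; ring
      rw [hs]
      have := hK_mul_sK ht hy hx'
      have h3 : 8 * sK t y x * hK t y x ^ 3 = 8 * hK t y x ^ 2 := by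
        linear_combination 8 * hK t y x ^ 2 * this
      rw [h3]
      simp [lap]; ring
    · refine integral_congr_ae ?_
      filter_upwards [sph_ae] with x hx
      have hn : ∑ j, x j * x j = 1 := by
        rw [← norm_sq_coord, mem_sphere_zero_iff_norm.1 hx]; norm_num
      rw [inner_coord x y, clm_coord (fderiv ℝ u x) x]
      simp only [hw, inner_sgl]
      simp only [Fin.sum_univ_four] at hn ⊢
      linear_combination (-4 * u x * hK t y x ^ 2) * hn
  · intro i _
    exact int_sph (((hwc i).continuousOn.mono (sphere_sub ht)).mul
      (continuous_id.inner continuous_const).continuousOn)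
  · intro i _
    exact int_ball (((((hwc i).fderiv_of_isOpen isOpen_ball (m := 0) (by norm_num)).continuousOn).clm_apply
      continuousOn_const).mono (closedBall_sub ht))

lemma sK_sph {t : ℝ} {y x : E 4} (hy : ‖y‖ = 1) (hx : ‖x‖ = 1) :
    sK t y x = 1 + t ^ 2 - 2 * t * inner ℝ x y := by
  rw [sK, norm_sub_sq_real, norm_smul, hx, hy, inner_smul_right, Real.norm_eq_abs]
  simp; ring

lemma green2 {t : ℝ} (ht : 1 < t) {y : E 4} (hy : ‖y‖ = 1) {u : E 4 → ℝ}
    (hu : ContDiffOn ℝ 2 u (ball 0 t)) :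
    ∫ x, hK t y x * (fderiv ℝ u x y - inner ℝ x y * fderiv ℝ u x x) ∂(sphMeasure 4)
      = ∫ x, u x * (3 * inner ℝ x y * hK t y x - 2 * t * (1 - inner ℝ x y ^ 2) * hK t y x ^ 2)
          ∂(sphMeasure 4) := by
  have hh := hK_contDiffOn ht hy 2
  have h1 := tang_sph ht (hu.mul hh) y
  have hci : ContinuousOn (fun x : E 4 => (inner ℝ x y : ℝ)) (sphere (0 : E 4) 1) :=
    (continuous_id.inner continuous_const).continuousOn
  have hcd : ContinuousOn (fun x : E 4 => fderiv ℝ u x y) (sphere (0 : E 4) 1) :=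
    (fderiv_dir_contDiffOn hu y).continuousOn.mono (sphere_sub ht)
  have hcd' : ContinuousOn (fun x : E 4 => fderiv ℝ u x x) (sphere (0 : E 4) 1) :=
    (fderiv_self_continuousOn hu).mono (sphere_sub ht)
  have hcg : ContinuousOn u (sphere (0 : E 4) 1) := hu.continuousOn.mono (sphere_sub ht)
  have hch : ContinuousOn (hK t y) (sphere (0 : E 4) 1) := hh.continuousOn.mono (sphere_sub ht)
  have e1 : ∫ x, (fderiv ℝ (fun x => u x * hK t y x) x y
      - inner ℝ x y * fderiv ℝ (fun x => u x * hK t y x) x x) ∂(sphMeasure 4)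
      = ∫ x, (hK t y x * (fderiv ℝ u x y - inner ℝ x y * fderiv ℝ u x x)
          + u x * (2 * t * (1 - inner ℝ x y ^ 2) * hK t y x ^ 2)) ∂(sphMeasure 4) := by
    refine integral_congr_ae ?_
    filter_upwards [sph_ae] with x hx
    have hx' := sphere_sub ht hx
    have hd := ((diffAt hu hx').hasFDerivAt.fun_mul (hK_hasFDeriv ht hy hx'))
    have hn : ‖x‖ = 1 := mem_sphere_zero_iff_norm.1 hx
    have i1 : (inner ℝ (x - t • y) y : ℝ) = inner ℝ x y - t := by
      rw [inner_sub_left, inner_smul_left, real_inner_self_eq_norm_sq, hy]; simp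
    have i2 : (inner ℝ (x - t • y) x : ℝ) = 1 - t * inner ℝ x y := by
      rw [inner_sub_left, inner_smul_left, real_inner_self_eq_norm_sq, hn, real_inner_comm]; simp
    rw [hd.fderiv]
    simp only [_root_.add_apply, _root_.smul_apply, innerSL_apply_apply, i1, i2,
      smul_eq_mul]
    ring
  have h1' : ∫ x, (fderiv ℝ (fun x => u x * hK t y x) x y
      - inner ℝ x y * fderiv ℝ (fun x => u x * hK t y x) x x) ∂(sphMeasure 4)
      = ∫ x, 3 * inner ℝ x y * (u x * hK t y x) ∂(sphMeasure 4) := h1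
  rw [e1] at h1'
  have I1 : Integrable (fun x => hK t y x * (fderiv ℝ u x y - inner ℝ x y * fderiv ℝ u x x)) (sphMeasure 4) :=
    int_sph (hch.mul (hcd.sub (hci.mul hcd')))
  have I2 : Integrable (fun x => u x * (2 * t * (1 - inner ℝ x y ^ 2) * hK t y x ^ 2)) (sphMeasure 4) :=
    int_sph (hcg.mul ((continuousOn_const.mul (continuousOn_const.sub (hci.pow 2))).mul (hch.pow 2)))
  have I3 : Integrable (fun x => 3 * inner ℝ x y * (u x * hK t y x)) (sphMeasure 4) :=
    int_sph ((continuousOn_const.mul hci).mul (hcg.mul hch))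
  rw [integral_add I1 I2] at h1'
  rw [eq_sub_of_add_eq h1', ← integral_sub I3 I2]
  congr 1; funext x; ring

lemma green {t : ℝ} (ht : 1 < t) {y : E 4} (hy : ‖y‖ = 1) {u : E 4 → ℝ}
    (hu : ContDiffOn ℝ 2 u (ball 0 t)) :
    (∫ x in ball (0 : E 4) 1, lap 4 u x * (2 - 2 * hK t y x))
      + ∫ x, 2 * t * hK t y x * (fderiv ℝ u x y - inner ℝ x y * fderiv ℝ u x x) ∂(sphMeasure 4)
      = (∫ x, fderiv ℝ u x x * (2 - 2 * hK t y x) ∂(sphMeasure 4))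
        + ∫ x, u x * ((t ^ 2 - 1) * hK t y x + (t ^ 4 - 1) * hK t y x ^ 2 - 2) ∂(sphMeasure 4) := by
  have hh := hK_contDiffOn ht hy 2
  have hci : ContinuousOn (fun x : E 4 => (inner ℝ x y : ℝ)) (sphere (0 : E 4) 1) :=
    (continuous_id.inner continuous_const).continuousOn
  have hcd' : ContinuousOn (fun x : E 4 => fderiv ℝ u x x) (sphere (0 : E 4) 1) :=
    (fderiv_self_continuousOn hu).mono (sphere_sub ht)
  have hcg : ContinuousOn u (sphere (0 : E 4) 1) := hu.continuousOn.mono (sphere_sub ht)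
  have hch : ContinuousOn (hK t y) (sphere (0 : E 4) 1) := hh.continuousOn.mono (sphere_sub ht)
  have g2 := green2 ht hy hu
  rw [green1 ht hy hu]
  have e : ∫ x, 2 * t * hK t y x * (fderiv ℝ u x y - inner ℝ x y * fderiv ℝ u x x) ∂(sphMeasure 4)
      = ∫ x, 2 * t * (u x * (3 * inner ℝ x y * hK t y x - 2 * t * (1 - inner ℝ x y ^ 2) * hK t y x ^ 2))
          ∂(sphMeasure 4) := by
    rw [integral_const_mul, ← g2, ← integral_const_mul]
    congr 1; funext x; ring
  rw [e, ← integral_add, ← integral_add]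
  · refine integral_congr_ae ?_
    filter_upwards [sph_ae] with x hx
    have hn : ‖x‖ = 1 := mem_sphere_zero_iff_norm.1 hx
    have h1 := sK_sph (t := t) hy hn
    have h2 := hK_mul_sK ht hy (sphere_sub ht hx)
    rw [h1] at h2
    generalize (inner ℝ x y : ℝ) = c at *
    generalize hK t y x = h at *
    linear_combination (u x * (-(3 + t ^ 2 + 2 * t * c) * h - 2)) * h2
  · exact int_sph (hcd'.mul (continuousOn_const.sub (continuousOn_const.mul hch)))
  · exact int_sph (hcg.mul (((continuousOn_const.mul hch).add (continuousOn_const.mul (hch.pow 2))).sub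
      continuousOn_const))
  · refine int_sph (ContinuousOn.sub (hcd'.mul (continuousOn_const.sub (continuousOn_const.mul hch))) ?_)
    exact ((continuousOn_const.mul hcg).mul (continuousOn_const.sub (continuousOn_const.mul hci))).mul (hch.pow 2)
  · exact int_sph (continuousOn_const.mul (hcg.mul (((continuousOn_const.mul hci).mul hch).sub
      ((continuousOn_const.mul (continuousOn_const.sub (hci.pow 2))).mul (hch.pow 2)))))

/-! ### Part 4 : the approximate identity and the kernel -/

/-- the approximate identity `W_t`. -/
def WK (t : ℝ) (y x : E 4) : ℝ :=
  (1 / (4 * Real.pi ^ 2)) * ((t ^ 2 - 1) * hK t y x + (t ^ 4 - 1) * hK t y x ^ 2)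

lemma hK_nonneg (t : ℝ) (y x : E 4) : 0 ≤ hK t y x := by
  unfold hK sK; positivity

lemma WK_nonneg {t : ℝ} (ht : 1 < t) (y x : E 4) : 0 ≤ WK t y x := by
  have h1 : 0 ≤ t ^ 2 - 1 := by nlinarith
  have h2 : 0 ≤ t ^ 4 - 1 := by nlinarith
  have := hK_nonneg t y x
  unfold WK; positivity

lemma hK_contOn {t : ℝ} (ht : 1 < t) {y : E 4} (hy : ‖y‖ = 1) :
    ContinuousOn (hK t y) (ball (0 : E 4) t) := (hK_contDiffOn ht hy 0).continuousOn

lemma WK_contOn {t : ℝ} (ht : 1 < t) {y : E 4} (hy : ‖y‖ = 1) :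
    ContinuousOn (WK t y) (sphere (0 : E 4) 1) := by
  have := (hK_contOn ht hy).mono (sphere_sub ht)
  exact continuousOn_const.mul ((continuousOn_const.mul this).add (continuousOn_const.mul (this.pow 2)))

lemma WK_pair {t : ℝ} (ht : 1 < t) {y : E 4} (hy : ‖y‖ = 1) {u : E 4 → ℝ}
    (hu : ContinuousOn u (sphere (0 : E 4) 1)) :
    ∫ x, u x * ((t ^ 2 - 1) * hK t y x + (t ^ 4 - 1) * hK t y x ^ 2 - 2) ∂(sphMeasure 4)
      = 4 * Real.pi ^ 2 * ((∫ x, WK t y x * u x ∂(sphMeasure 4))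
          - (1 / (2 * Real.pi ^ 2)) * ∫ x, u x ∂(sphMeasure 4)) := by
  have I1 : Integrable (fun x => 4 * Real.pi ^ 2 * (WK t y x * u x)) (sphMeasure 4) :=
    (int_sph ((WK_contOn ht hy).mul hu)).const_mul _
  have I2 : Integrable (fun x => 2 * u x) (sphMeasure 4) := (int_sph hu).const_mul _
  have hp : Real.pi ≠ 0 := Real.pi_ne_zero
  have e : ∀ x, u x * ((t ^ 2 - 1) * hK t y x + (t ^ 4 - 1) * hK t y x ^ 2 - 2)
      = 4 * Real.pi ^ 2 * (WK t y x * u x) - 2 * u x := by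
    intro x; unfold WK; field_simp
  simp only [e]
  rw [integral_sub I1 I2, integral_const_mul, integral_const_mul]
  field_simp
  ring

lemma WK_mass {t : ℝ} (ht : 1 < t) {y : E 4} (hy : ‖y‖ = 1) :
    ∫ x, WK t y x ∂(sphMeasure 4) = 1 := by
  have h := green ht hy (u := fun _ => (1:ℝ)) contDiffOn_const
  rw [WK_pair ht hy continuousOn_const] at h
  have hp : Real.pi ≠ 0 := Real.pi_ne_zero
  simp [lap, sph_univ] at h
  field_simp at h
  linarith

/-- Pairing of a Neumann function with the kernel. -/
lemma pair_A {t : ℝ} (ht : 1 < t) {y : E 4} (hy : ‖y‖ = 1) {u : E 4 → ℝ} (hu : ContDiff ℝ 2 u)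
    (hN : ∀ x ∈ sphere (0 : E 4) 1, fderiv ℝ u x x = 0) :
    (∫ x in ball (0 : E 4) 1, lap 4 u x * (2 - 2 * hK t y x))
      + ∫ x, 2 * t * hK t y x * (fderiv ℝ u x y - inner ℝ x y * fderiv ℝ u x x) ∂(sphMeasure 4)
    = 4 * Real.pi ^ 2 * ((∫ x, WK t y x * u x ∂(sphMeasure 4))
          - (1 / (2 * Real.pi ^ 2)) * ∫ x, u x ∂(sphMeasure 4)) := by
  rw [green ht hy hu.contDiffOn, WK_pair ht hy hu.continuous.continuousOn]
  have : ∫ x, fderiv ℝ u x x * (2 - 2 * hK t y x) ∂(sphMeasure 4) = ∫ x, (0:ℝ) ∂(sphMeasure 4) := by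
    refine integral_congr_ae ?_
    filter_upwards [sph_ae] with x hx
    rw [hN x hx]; simp
  rw [this]; simp

/-- the kernel function. -/
def KK (t : ℝ) (z x : E 4) : ℝ := -(1/2) * Real.log (sK t z x) + ‖x‖ ^ 2 / 4

lemma KK_contDiffOn {t : ℝ} (ht : 1 < t) {z : E 4} (hz : ‖z‖ = 1) (n : WithTop ℕ∞) :
    ContDiffOn ℝ n (KK t z) (ball 0 t) := by
  unfold KK
  refine (contDiffOn_const.mul ((sK_contDiff t z n).contDiffOn.log fun x hx => (sK_pos ht hz hx).ne')).add ?_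
  exact ((contDiff_norm_sq ℝ).contDiffOn).div_const _

lemma KK_fderiv {t : ℝ} (ht : 1 < t) {z : E 4} (hz : ‖z‖ = 1) {x : E 4} (hx : x ∈ ball (0 : E 4) t) (v : E 4) :
    fderiv ℝ (KK t z) x v = - (inner ℝ x v - t * inner ℝ z v) * hK t z x + inner ℝ x v / 2 := by
  have h1 := ((sK_hasFDeriv t z x).log (sK_pos ht hz hx).ne').const_mul (-(1/2))
  have h2 := (hasStrictFDerivAt_norm_sq x).hasFDerivAt.mul_const (1/4 : ℝ)
  have h3 := h1.fun_add h2
  have e : KK t z = fun x => -(1/2) * Real.log (sK t z x) + ‖x‖ ^ 2 * (1/4) := by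
    funext x; unfold KK; ring
  rw [e, h3.fderiv]
  have i1 : (inner ℝ (x - t • z) v : ℝ) = inner ℝ x v - t * inner ℝ z v := by
    rw [inner_sub_left, inner_smul_left]; simp
  simp only [_root_.add_apply, _root_.smul_apply, innerSL_apply_apply, i1, smul_eq_mul, hK]
  simp
  ring

lemma KK_lap {t : ℝ} (ht : 1 < t) {z : E 4} (hz : ‖z‖ = 1) {x : E 4} (hx : x ∈ ball (0 : E 4) t) :
    lap 4 (KK t z) x = 2 - 2 * hK t z x := by
  have hi : ∀ i : Fin 4, fderiv ℝ (fun w => fderiv ℝ (KK t z) w (EuclideanSpace.single i 1)) x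
      (EuclideanSpace.single i 1) = - hK t z x + 2 * (x i - t * z i) ^ 2 * hK t z x ^ 2 + 1 / 2 := by
    intro i
    have e : (fun w => fderiv ℝ (KK t z) w (EuclideanSpace.single i 1)) =ᶠ[nhds x]
        fun w => - (w i - t * z i) * hK t z w + w i * (1 / 2) := by
      filter_upwards [isOpen_ball.mem_nhds hx] with w hw
      rw [KK_fderiv ht hz hw, inner_sgl, inner_sgl]; ring
    rw [e.fderiv_eq]
    have h1 := (((coord_hasFDeriv i x).sub_const (t * z i)).fun_neg).fun_mul (hK_hasFDeriv ht hz hx)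
    have h2 := (coord_hasFDeriv i x).mul_const (1/2 : ℝ)
    rw [(h1.fun_add h2).fderiv]
    have i1 : (inner ℝ (x - t • z) (EuclideanSpace.single i (1:ℝ)) : ℝ) = x i - t * z i := by
      rw [inner_sgl]; simp
    simp only [_root_.add_apply, _root_.smul_apply, innerSL_apply_apply, i1, smul_eq_mul]
    simp
    ring
  unfold lap
  simp only [hi]
  have hs : sK t z x = ∑ i, (x i - t * z i) ^ 2 := by
    rw [sK, norm_sq_coord]
    refine Finset.sum_congr rfl fun i _ => ?_
    simp; ring
  have := hK_mul_sK ht hz hx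
  rw [hs] at this
  simp only [Fin.sum_univ_four] at this ⊢
  linear_combination 2 * hK t z x * this

lemma sK_le_nine {t : ℝ} (ht : 1 < t) (ht2 : t ≤ 2) {z x : E 4} (hz : ‖z‖ = 1) (hx : ‖x‖ ≤ 1) :
    sK t z x ≤ 9 := by
  have h1 : ‖t • z‖ = t := by rw [norm_smul, hz, Real.norm_of_nonneg (by linarith), mul_one]
  have h2 := norm_sub_le x (t • z)
  unfold sK
  nlinarith [norm_nonneg (x - t • z)]

lemma hK_contS {t : ℝ} (ht : 1 < t) {y : E 4} (hy : ‖y‖ = 1) :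
    ContinuousOn (hK t y) (sphere (0 : E 4) 1) := (hK_contOn ht hy).mono (sphere_sub ht)

lemma logs_contS {t : ℝ} (ht : 1 < t) {z : E 4} (hz : ‖z‖ = 1) :
    ContinuousOn (fun x => -(1/2) * Real.log (sK t z x)) (sphere (0 : E 4) 1) :=
  continuousOn_const.mul (((sK_contDiff t z 0).continuous.continuousOn).log
    fun x hx => (sK_pos ht hz (sphere_sub ht hx)).ne')

lemma pair_B {t : ℝ} (ht : 1 < t) (ht2 : t ≤ 2) {y z : E 4} (hy : ‖y‖ = 1) (hz : ‖z‖ = 1) :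
    (∫ x in ball (0 : E 4) 1, (2 - 2 * hK t z x) * (2 - 2 * hK t y x))
      + ∫ x, 2 * t ^ 2 * hK t y x * hK t z x * (inner ℝ z y - inner ℝ x z * inner ℝ x y) ∂(sphMeasure 4)
    ≤ 4 * Real.pi ^ 2 * ((∫ x, WK t y x * (-(1/2) * Real.log (sK t z x)) ∂(sphMeasure 4)) + 4) := by
  have g := green ht hy (KK_contDiffOn ht hz 2)
  rw [WK_pair ht hy ((KK_contDiffOn ht hz 0).continuousOn.mono (sphere_sub ht))] at g
  have pp : 0 < Real.pi := Real.pi_pos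
  have e1 : ∫ x in ball (0 : E 4) 1, lap 4 (KK t z) x * (2 - 2 * hK t y x)
      = ∫ x in ball (0 : E 4) 1, (2 - 2 * hK t z x) * (2 - 2 * hK t y x) := by
    refine setIntegral_congr_fun measurableSet_ball fun x hx => ?_
    rw [KK_lap ht hz (ball_subset_ball ht.le hx)]
  have hD : ∀ x ∈ sphere (0 : E 4) 1, fderiv ℝ (KK t z) x x = (t ^ 2 - 1) / 2 * hK t z x := by
    intro x hx
    have hn : ‖x‖ = 1 := mem_sphere_zero_iff_norm.1 hx
    have h2 := hK_mul_sK ht hz (sphere_sub ht hx)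
    rw [KK_fderiv ht hz (sphere_sub ht hx), real_inner_self_eq_norm_sq, hn, real_inner_comm]
    rw [sK_sph hz hn] at h2
    linear_combination (-1/2) * h2
  have e2 : ∫ x, 2 * t * hK t y x * (fderiv ℝ (KK t z) x y - inner ℝ x y * fderiv ℝ (KK t z) x x) ∂(sphMeasure 4)
      = ∫ x, 2 * t ^ 2 * hK t y x * hK t z x * (inner ℝ z y - inner ℝ x z * inner ℝ x y) ∂(sphMeasure 4) := by
    refine integral_congr_ae ?_
    filter_upwards [sph_ae] with x hx
    have hn : ‖x‖ = 1 := mem_sphere_zero_iff_norm.1 hx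
    rw [KK_fderiv ht hz (sphere_sub ht hx), KK_fderiv ht hz (sphere_sub ht hx),
      real_inner_self_eq_norm_sq, hn, real_inner_comm x z]
    ring
  have b1 : ∫ x, fderiv ℝ (KK t z) x x * (2 - 2 * hK t y x) ∂(sphMeasure 4) ≤ 4 * Real.pi ^ 2 := by
    calc _ ≤ ∫ x, 4 * Real.pi ^ 2 * WK t z x ∂(sphMeasure 4) := by
          refine integral_mono_ae ?_ ?_ ?_
          · exact int_sph (((fderiv_self_continuousOn (KK_contDiffOn ht hz 2)).mono (sphere_sub ht)).mul
              (continuousOn_const.sub (continuousOn_const.mul (hK_contS ht hy))))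
          · exact int_sph (continuousOn_const.mul (WK_contOn ht hz))
          · filter_upwards [sph_ae] with x hx
            rw [hD x hx]
            unfold WK
            have a1 := hK_nonneg t y x
            have a2 := hK_nonneg t z x
            have h1 : 0 ≤ t ^ 2 - 1 := by nlinarith
            have h2 : 0 ≤ t ^ 4 - 1 := by nlinarith
            field_simp
            have := mul_nonneg (mul_nonneg h1 a2) a1
            have := mul_nonneg h2 (sq_nonneg (hK t z x))
            nlinarith
      _ = 4 * Real.pi ^ 2 := by rw [integral_const_mul, WK_mass ht hz, mul_one]
  have hl3 : Real.log 9 ≤ 4 := by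
    have := Real.log_le_sub_one_of_pos (show (0:ℝ) < 3 by norm_num)
    have h9 : Real.log 9 = 2 * Real.log 3 := by
      rw [show (9:ℝ) = 3 ^ 2 by norm_num, Real.log_pow]; norm_num
    linarith
  have cK : ContinuousOn (KK t z) (sphere (0 : E 4) 1) := (KK_contDiffOn ht hz 0).continuousOn.mono (sphere_sub ht)
  have b2 : -2 * (2 * Real.pi ^ 2) ≤ ∫ x, KK t z x ∂(sphMeasure 4) := by
    calc _ = ∫ x, (-2 : ℝ) ∂(sphMeasure 4) := by rw [integral_const, sph_univ]; simp; ring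
      _ ≤ _ := by
        refine integral_mono_ae (integrable_const _) (int_sph cK) ?_
        filter_upwards [sph_ae] with x hx
        have hn : ‖x‖ = 1 := mem_sphere_zero_iff_norm.1 hx
        have := Real.log_le_log (sK_pos ht hz (sphere_sub ht hx)) (sK_le_nine ht ht2 hz hn.le)
        unfold KK; rw [hn]; linarith
  have b3 : ∫ x, WK t y x * KK t z x ∂(sphMeasure 4) =
      (∫ x, WK t y x * (-(1/2) * Real.log (sK t z x)) ∂(sphMeasure 4)) + 1 / 4 := by
    have : ∫ x, WK t y x * (1/4) ∂(sphMeasure 4) = 1 / 4 := by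
      rw [integral_mul_const, WK_mass ht hy]; norm_num
    rw [← this, ← integral_add]
    · refine integral_congr_ae ?_
      filter_upwards [sph_ae] with x hx
      have hn : ‖x‖ = 1 := mem_sphere_zero_iff_norm.1 hx
      unfold KK; rw [hn]; ring
    · exact int_sph ((WK_contOn ht hy).mul (logs_contS ht hz))
    · exact int_sph ((WK_contOn ht hy).mul continuousOn_const)
  rw [e1, e2, b3] at g
  rw [g]
  have b4 : - ((1 / (2 * Real.pi ^ 2)) * ∫ x, KK t z x ∂(sphMeasure 4)) ≤ 2 := by
    have : (0:ℝ) < 2 * Real.pi ^ 2 := by positivity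
    rw [← mul_neg, one_div, inv_mul_le_iff₀ this]; linarith
  have : 0 < Real.pi ^ 2 := by positivity
  nlinarith

/-! ### Part 5 : Fubini and Cauchy-Schwarz -/

section generic
variable {X Y F : Type*} [MeasurableSpace X] [MeasurableSpace Y] [NormedAddCommGroup F]
  [InnerProductSpace ℝ F] [CompleteSpace F]

lemma fub_inner (μ : Measure X) (ν : Measure Y) [IsFiniteMeasure μ] [IsFiniteMeasure ν]
    {A : Set X} {S : Set Y} {g : X → F} {b : X → Y → F} {C C' : ℝ}
    (hA : ∀ᵐ x ∂μ, x ∈ A) (hS : ∀ᵐ y ∂ν, y ∈ S)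
    (hg : AEStronglyMeasurable g μ) (hgb : ∀ x ∈ A, ‖g x‖ ≤ C)
    (hb : StronglyMeasurable (Function.uncurry b)) (hbb : ∀ x ∈ A, ∀ y ∈ S, ‖b x y‖ ≤ C') :
    Integrable (fun y => ∫ x, inner ℝ (g x) (b x y) ∂μ) ν ∧
    ∫ y, ∫ x, inner ℝ (g x) (b x y) ∂μ ∂ν = ∫ x, inner ℝ (g x) (∫ y, b x y ∂ν) ∂μ := by
  have J : Integrable (Function.uncurry fun x y => (inner ℝ (g x) (b x y) : ℝ)) (μ.prod ν) := by
    refine Integrable.of_bound (C := |C| * |C'|) ?_ ?_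
    · exact (AEStronglyMeasurable.inner (𝕜 := ℝ) (hg.comp_fst) hb.aestronglyMeasurable :)
    · filter_upwards [Measure.quasiMeasurePreserving_fst.ae hA, Measure.quasiMeasurePreserving_snd.ae hS]
        with p h1 h2
      refine (norm_inner_le_norm _ _).trans ?_
      have a := hgb _ h1
      have c := hbb _ h1 _ h2
      exact mul_le_mul (a.trans (le_abs_self _)) (c.trans (le_abs_self _)) (norm_nonneg _) (abs_nonneg _)
  refine ⟨J.integral_prod_right, ?_⟩
  rw [← integral_integral_swap J]
  refine integral_congr_ae ?_
  filter_upwards [hA] with x hx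
  refine integral_inner (f := fun y => b x y) ?_ (g x)
  refine Integrable.of_bound (C := C') (hb.comp_measurable measurable_prodMk_left).aestronglyMeasurable ?_
  filter_upwards [hS] with y hy using hbb x hx y hy

lemma cs_inner (μ : Measure X) (ν : Measure Y) [IsFiniteMeasure μ] [IsProbabilityMeasure ν]
    {A : Set X} {S : Set Y} {g : X → F} {b : X → Y → F} {C C' l : ℝ} (hl : 0 < l)
    (hA : ∀ᵐ x ∂μ, x ∈ A) (hS : ∀ᵐ y ∂ν, y ∈ S)
    (hg : AEStronglyMeasurable g μ) (hgb : ∀ x ∈ A, ‖g x‖ ≤ C)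
    (hb : StronglyMeasurable (Function.uncurry b)) (hbb : ∀ x ∈ A, ∀ y ∈ S, ‖b x y‖ ≤ C') :
    Integrable (fun y => ∫ z, ∫ x, inner ℝ (b x y) (b x z) ∂μ ∂ν) ν ∧
    (∀ y ∈ S, Integrable (fun z => ∫ x, inner ℝ (b x y) (b x z) ∂μ) ν) ∧
    2 * ∫ y, ∫ x, inner ℝ (g x) (b x y) ∂μ ∂ν ≤ l * ∫ x, ‖g x‖ ^ 2 ∂μ
      + l⁻¹ * ∫ y, ∫ z, ∫ x, inner ℝ (b x y) (b x z) ∂μ ∂ν ∂ν := by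
  set H : X → F := fun x => ∫ y, b x y ∂ν with hH
  have hHm : StronglyMeasurable H := hb.integral_prod_right
  have hHb : ∀ x ∈ A, ‖H x‖ ≤ C' := by
    intro x hx
    have := norm_integral_le_of_norm_le_const (μ := ν) (f := fun y => b x y) (C := C')
      (by filter_upwards [hS] with y hy using hbb x hx y hy)
    simpa using this
  have f0 := fub_inner μ ν hA hS hg hgb hb hbb
  have f1 := fub_inner μ ν hA hS hHm.aestronglyMeasurable hHb hb hbb
  have f2 := fun y (hy : y ∈ S) => fub_inner μ ν (g := fun x => b x y) hA hS
    (hb.comp_measurable measurable_prodMk_right).aestronglyMeasurable (fun x hx => hbb x hx y hy) hb hbb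
  have e : ∀ y ∈ S, ∫ z, ∫ x, inner ℝ (b x y) (b x z) ∂μ ∂ν = ∫ x, inner ℝ (H x) (b x y) ∂μ := by
    intro y hy
    rw [(f2 y hy).2]
    congr 1; funext x; exact real_inner_comm _ _
  have eae : (fun y => ∫ z, ∫ x, inner ℝ (b x y) (b x z) ∂μ ∂ν) =ᵐ[ν]
      fun y => ∫ x, inner ℝ (H x) (b x y) ∂μ := by
    filter_upwards [hS] with y hy using e y hy
  refine ⟨f1.1.congr eae.symm, fun y hy => (f2 y hy).1, ?_⟩
  rw [integral_congr_ae eae, f1.2, f0.2, ← integral_const_mul, ← integral_const_mul, ← integral_const_mul]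
  have Ig : Integrable (fun x => l * ‖g x‖ ^ 2) μ := by
    refine Integrable.const_mul ?_ _
    refine Integrable.of_bound (C := C ^ 2) (hg.norm.pow 2) ?_
    filter_upwards [hA] with x hx
    rw [Real.norm_of_nonneg (by positivity)]
    have := hgb x hx; gcongr
  have IH : Integrable (fun x => l⁻¹ * (inner ℝ (H x) (H x) : ℝ)) μ := by
    refine Integrable.const_mul ?_ _
    refine Integrable.of_bound (C := C' ^ 2) ?_ ?_
    · exact (AEStronglyMeasurable.inner (𝕜 := ℝ) hHm.aestronglyMeasurable hHm.aestronglyMeasurable :)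
    · filter_upwards [hA] with x hx
      rw [real_inner_self_eq_norm_sq, Real.norm_of_nonneg (by positivity)]
      have := hHb x hx; gcongr
  have Ic : Integrable (fun x => 2 * (inner ℝ (g x) (H x) : ℝ)) μ := by
    refine Integrable.const_mul ?_ _
    refine Integrable.of_bound (C := |C| * |C'|) ?_ ?_
    · exact (AEStronglyMeasurable.inner (𝕜 := ℝ) hg hHm.aestronglyMeasurable :)
    · filter_upwards [hA] with x hx
      refine (norm_inner_le_norm _ _).trans ?_
      exact mul_le_mul ((hgb x hx).trans (le_abs_self _)) ((hHb x hx).trans (le_abs_self _))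
        (norm_nonneg _) (abs_nonneg _)
  rw [← integral_add Ig IH]
  refine integral_mono Ic (Ig.add IH) fun x => ?_
  simp only [Pi.add_apply]
  rw [real_inner_self_eq_norm_sq]
  have h1 := real_inner_le_norm (g x) (H x)
  have h2 : 0 ≤ l⁻¹ * (l * ‖g x‖ - ‖H x‖) ^ 2 := by positivity
  have h3 : l⁻¹ * (l * ‖g x‖ - ‖H x‖) ^ 2 = l * ‖g x‖ ^ 2 + l⁻¹ * ‖H x‖ ^ 2 - 2 * (‖g x‖ * ‖H x‖) := by
    field_simp; ring
  linarith

end generic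

lemma sK_meas (t : ℝ) : Measurable (fun p : E 4 × E 4 => sK t p.2 p.1) := by
  unfold sK; fun_prop

lemma hK_meas (t : ℝ) : Measurable (fun p : E 4 × E 4 => hK t p.2 p.1) := (sK_meas t).inv

lemma WK_meas (t : ℝ) : Measurable (fun p : E 4 × E 4 => WK t p.2 p.1) := by
  have := hK_meas t
  unfold WK; fun_prop

lemma logs_meas (t : ℝ) : Measurable (fun p : E 4 × E 4 => -(1/2) * Real.log (sK t p.2 p.1)) :=
  ((sK_meas t).log).const_mul _

lemma sK_lower' {t : ℝ} (ht : 1 < t) {y x : E 4} (hy : ‖y‖ = 1) (hx : ‖x‖ ≤ 1) :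
    (t - 1) ^ 2 ≤ sK t y x := by
  refine le_trans ?_ (sK_lower ht hy (by linarith))
  have : 0 ≤ t - 1 := by linarith
  gcongr

lemma hK_le {t : ℝ} (ht : 1 < t) {y x : E 4} (hy : ‖y‖ = 1) (hx : ‖x‖ ≤ 1) :
    hK t y x ≤ ((t - 1) ^ 2)⁻¹ := by
  have : 0 < t - 1 := by linarith
  unfold hK
  exact inv_anti₀ (by positivity) (sK_lower' ht hy hx)

lemma logs_bound {t : ℝ} (ht : 1 < t) (ht2 : t ≤ 2) {y x : E 4} (hy : ‖y‖ = 1) (hx : ‖x‖ ≤ 1) :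
    ‖-(1/2) * Real.log (sK t y x)‖ ≤ |Real.log ((t - 1) ^ 2)| + |Real.log 9| := by
  have h0 : 0 < (t - 1) ^ 2 := by have : 0 < t - 1 := by linarith
                                  positivity
  have h1 := Real.log_le_log h0 (sK_lower' ht hy hx)
  have h2 := Real.log_le_log (h0.trans_le (sK_lower' ht hy hx)) (sK_le_nine ht ht2 hy hx)
  have h3 := neg_abs_le (Real.log ((t - 1) ^ 2))
  have h4 := le_abs_self (Real.log 9)
  have h5 := abs_nonneg (Real.log ((t - 1) ^ 2))
  have h6 := abs_nonneg (Real.log 9)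
  rw [Real.norm_eq_abs, abs_le]
  constructor <;> linarith

/-- the logarithmic potential of `ν`. -/
def Phi (t : ℝ) (ν : Measure (E 4)) (x : E 4) : ℝ := ∫ z, -(1/2) * Real.log (sK t z x) ∂ν

/-- The `W`-average of the potential. -/
lemma WPhi {t : ℝ} (ht : 1 < t) (ht2 : t ≤ 2) (ν : Measure (E 4)) [IsFiniteMeasure ν]
    (hν : ∀ᵐ y ∂ν, y ∈ sphere (0 : E 4) 1) {y : E 4} (hy : ‖y‖ = 1) :
    Integrable (fun z => ∫ x, WK t y x * (-(1/2) * Real.log (sK t z x)) ∂(sphMeasure 4)) ν ∧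
    ∫ z, ∫ x, WK t y x * (-(1/2) * Real.log (sK t z x)) ∂(sphMeasure 4) ∂ν
      = ∫ x, WK t y x * Phi t ν x ∂(sphMeasure 4) := by
  obtain ⟨C, hC⟩ := (isCompact_sphere (0 : E 4) 1).exists_bound_of_continuousOn (WK_contOn ht hy)
  have := fub_inner (F := ℝ) (sphMeasure 4) ν (g := WK t y)
    (b := fun x z => -(1/2) * Real.log (sK t z x)) sph_ae hν
    (int_sph (WK_contOn ht hy)).aestronglyMeasurable hC (logs_meas t).stronglyMeasurable
    (fun x hx z hz => logs_bound ht ht2 (mem_sphere_zero_iff_norm.1 hz) (mem_sphere_zero_iff_norm.1 hx).le)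
  simpa only [real_inner_eq_re_inner, RCLike.inner_apply, conj_trivial, RCLike.re_to_real, mul_comm, Phi] using this

/-! ### Part 6 : the capacity inequality -/

lemma WK_bound {t : ℝ} (ht : 1 < t) {y x : E 4} (hy : ‖y‖ = 1) (hx : ‖x‖ ≤ 1) :
    ‖WK t y x‖ ≤ (1 / (4 * Real.pi ^ 2)) * ((t ^ 2 - 1) * ((t - 1) ^ 2)⁻¹ + (t ^ 4 - 1) * (((t - 1) ^ 2)⁻¹) ^ 2) := by
  rw [Real.norm_of_nonneg (WK_nonneg ht y x), WK]
  have h1 : 0 ≤ t ^ 2 - 1 := by nlinarith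
  have h2 : 0 ≤ t ^ 4 - 1 := by nlinarith
  have := hK_nonneg t y x
  have := hK_le ht hy hx
  gcongr

/-- integrability of `y ↦ ∫ W(x,y) v(x)`. -/
lemma WK_int {t : ℝ} (ht : 1 < t) (ν : Measure (E 4)) [IsFiniteMeasure ν]
    (hν : ∀ᵐ y ∂ν, y ∈ sphere (0 : E 4) 1) {v : E 4 → ℝ} (hv : AEStronglyMeasurable v (sphMeasure 4))
    {C : ℝ} (hC : ∀ x ∈ sphere (0 : E 4) 1, ‖v x‖ ≤ C) :
    Integrable (fun y => ∫ x, WK t y x * v x ∂(sphMeasure 4)) ν := by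
  have := (fub_inner (F := ℝ) (sphMeasure 4) ν (g := v)
    (b := fun x y => WK t y x) sph_ae hν hv hC (WK_meas t).stronglyMeasurable
    (fun x hx z hz => WK_bound ht (mem_sphere_zero_iff_norm.1 hz) (mem_sphere_zero_iff_norm.1 hx).le)).1
  simpa only [real_inner_eq_re_inner, RCLike.inner_apply, conj_trivial, RCLike.re_to_real] using this

lemma Phi_meas (t : ℝ) (ν : Measure (E 4)) [SFinite ν] : StronglyMeasurable (Phi t ν) :=
  (logs_meas t).stronglyMeasurable.integral_prod_right

lemma Phi_bound {t : ℝ} (ht : 1 < t) (ht2 : t ≤ 2) (ν : Measure (E 4)) [IsFiniteMeasure ν]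
    (hν : ∀ᵐ y ∂ν, y ∈ sphere (0 : E 4) 1) {x : E 4} (hx : x ∈ sphere (0 : E 4) 1) :
    ‖Phi t ν x‖ ≤ (|Real.log ((t - 1) ^ 2)| + |Real.log 9|) * ν.real Set.univ := by
  refine norm_integral_le_of_norm_le_const ?_
  filter_upwards [hν] with z hz
  exact logs_bound ht ht2 (mem_sphere_zero_iff_norm.1 hz) (mem_sphere_zero_iff_norm.1 hx).le

lemma lap_cont {u : E 4 → ℝ} (hu : ContDiff ℝ 2 u) : Continuous (lap 4 u) := by
  unfold lap
  refine continuous_finsetSum _ fun i _ => ?_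
  have h1 : ContDiff ℝ 1 (fun y => fderiv ℝ u y (EuclideanSpace.single i 1)) :=
    (hu.fderiv_right (m := 1) (by norm_num)).clm_apply contDiff_const
  exact (h1.continuous_fderiv (by norm_num)).clm_apply continuous_const

lemma grad_cont {u : E 4 → ℝ} (hu : ContDiff ℝ 2 u) : Continuous (gradient u) := by
  unfold gradient
  exact (InnerProductSpace.toDual ℝ (E 4)).symm.continuous.comp (hu.continuous_fderiv (by norm_num))

lemma grad_inner (u : E 4 → ℝ) (x v : E 4) : (inner ℝ (gradient u x) v : ℝ) = fderiv ℝ u x v := by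
  unfold gradient; simp

section realv
variable {X Y : Type*} [MeasurableSpace X] [MeasurableSpace Y]

lemma fub_real (μ : Measure X) (ν : Measure Y) [IsFiniteMeasure μ] [IsFiniteMeasure ν]
    {A : Set X} {S : Set Y} {g : X → ℝ} {b : X → Y → ℝ} {C C' : ℝ}
    (hA : ∀ᵐ x ∂μ, x ∈ A) (hS : ∀ᵐ y ∂ν, y ∈ S)
    (hg : AEStronglyMeasurable g μ) (hgb : ∀ x ∈ A, ‖g x‖ ≤ C)
    (hb : StronglyMeasurable (Function.uncurry b)) (hbb : ∀ x ∈ A, ∀ y ∈ S, ‖b x y‖ ≤ C') :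
    Integrable (fun y => ∫ x, g x * b x y ∂μ) ν ∧
    ∫ y, ∫ x, g x * b x y ∂μ ∂ν = ∫ x, g x * (∫ y, b x y ∂ν) ∂μ := by
  have := fub_inner (F := ℝ) μ ν hA hS hg hgb hb hbb
  simpa only [real_inner_eq_re_inner, RCLike.inner_apply, conj_trivial, RCLike.re_to_real, mul_comm] using this

lemma cs_real (μ : Measure X) (ν : Measure Y) [IsFiniteMeasure μ] [IsProbabilityMeasure ν]
    {A : Set X} {S : Set Y} {g : X → ℝ} {b : X → Y → ℝ} {C C' l : ℝ} (hl : 0 < l)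
    (hA : ∀ᵐ x ∂μ, x ∈ A) (hS : ∀ᵐ y ∂ν, y ∈ S)
    (hg : AEStronglyMeasurable g μ) (hgb : ∀ x ∈ A, ‖g x‖ ≤ C)
    (hb : StronglyMeasurable (Function.uncurry b)) (hbb : ∀ x ∈ A, ∀ y ∈ S, ‖b x y‖ ≤ C') :
    Integrable (fun y => ∫ z, ∫ x, b x z * b x y ∂μ ∂ν) ν ∧
    (∀ y ∈ S, Integrable (fun z => ∫ x, b x z * b x y ∂μ) ν) ∧
    2 * ∫ y, ∫ x, g x * b x y ∂μ ∂ν ≤ l * ∫ x, g x ^ 2 ∂μ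
      + l⁻¹ * ∫ y, ∫ z, ∫ x, b x z * b x y ∂μ ∂ν ∂ν := by
  have := cs_inner (F := ℝ) μ ν hl hA hS hg hgb hb hbb
  simpa only [real_inner_eq_re_inner, RCLike.inner_apply, conj_trivial, RCLike.re_to_real, mul_comm,
    Real.norm_eq_abs, sq_abs] using this

end realv

lemma cap {t : ℝ} (ht : 1 < t) (ht2 : t ≤ 2) {u : E 4 → ℝ} (hu : ContDiff ℝ 2 u)
    (hN : ∀ x ∈ sphere (0 : E 4) 1, fderiv ℝ u x x = 0)
    (ν : Measure (E 4)) [IsProbabilityMeasure ν]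
    (hν : ∀ᵐ y ∂ν, y ∈ sphere (0 : E 4) 1) {l : ℝ} (hl : 0 < l) :
    8 * Real.pi ^ 2 * ((∫ y, ∫ x, WK t y x * u x ∂(sphMeasure 4) ∂ν)
        - (1 / (2 * Real.pi ^ 2)) * ∫ x, u x ∂(sphMeasure 4))
      ≤ l * ((∫ x in ball (0 : E 4) 1, (lap 4 u x) ^ 2) + 2 * ∫ x, tgradNormSq 4 u x ∂(sphMeasure 4))
        + l⁻¹ * (4 * Real.pi ^ 2 * ((∫ y, ∫ x, WK t y x * Phi t ν x ∂(sphMeasure 4) ∂ν) + 4)) := by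
  have hn : ∀ {x : E 4}, x ∈ sphere (0 : E 4) 1 → ‖x‖ = 1 := fun h => mem_sphere_zero_iff_norm.1 h
  have hball : ∀ᵐ x ∂(volume.restrict (ball (0 : E 4) 1)), x ∈ closedBall (0 : E 4) 1 := by
    filter_upwards [ae_restrict_mem measurableSet_ball] with x hx using ball_subset_closedBall hx
  set H := ((t - 1) ^ 2)⁻¹ with hH
  haveI : IsFiniteMeasure (volume.restrict (ball (0 : E 4) 1)) :=
    ⟨by rw [Measure.restrict_apply_univ]; exact measure_ball_lt_top⟩
  -- ball part
  obtain ⟨C1, hC1⟩ := (isCompact_closedBall (0 : E 4) 1).exists_bound_of_continuousOn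
    (lap_cont hu).continuousOn
  have mb0 : Measurable (Function.uncurry fun x y : E 4 => 2 - 2 * hK t y x) :=
    (measurable_const.sub ((hK_meas t).const_mul 2))
  have c0 := cs_real (volume.restrict (ball (0 : E 4) 1)) ν (g := lap 4 u)
    (b := fun x y => 2 - 2 * hK t y x) hl hball hν (lap_cont hu).aestronglyMeasurable hC1
    mb0.stronglyMeasurable (C' := 2 + 2 * H) (by
      intro x hx y hy
      have h1 := hK_le ht (hn hy) (by simpa using hx : ‖x‖ ≤ 1)
      have h2 := hK_nonneg t y x
      rw [Real.norm_eq_abs, abs_le]; constructor <;> linarith)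
  have f0 := (fub_real (volume.restrict (ball (0 : E 4) 1)) ν (g := lap 4 u)
    (b := fun x y => 2 - 2 * hK t y x) hball hν (lap_cont hu).aestronglyMeasurable hC1
    mb0.stronglyMeasurable (C' := 2 + 2 * H) (by
      intro x hx y hy
      have h1 := hK_le ht (hn hy) (by simpa using hx : ‖x‖ ≤ 1)
      have h2 := hK_nonneg t y x
      rw [Real.norm_eq_abs, abs_le]; constructor <;> linarith)).1
  -- sphere part
  set r2 := Real.sqrt 2 with hr2
  have hr2sq : r2 * r2 = 2 := Real.mul_self_sqrt (by norm_num)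
  have cg : Continuous fun x => r2 • gradient u x := (grad_cont hu).const_smul r2
  obtain ⟨C2, hC2⟩ := (isCompact_sphere (0 : E 4) 1).exists_bound_of_continuousOn cg.continuousOn
  have mb1 : Measurable (Function.uncurry fun x y : E 4 => (r2 * t * hK t y x) • (y - (inner ℝ x y : ℝ) • x)) := by
    have h1 := hK_meas t
    have h2 : Measurable (fun p : E 4 × E 4 => p.2 - (inner ℝ p.1 p.2 : ℝ) • p.1) := by fun_prop
    exact (h1.const_mul (r2 * t)).smul h2
  have bb1 : ∀ x ∈ sphere (0 : E 4) 1, ∀ y ∈ sphere (0 : E 4) 1,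
      ‖(r2 * t * hK t y x) • (y - (inner ℝ x y : ℝ) • x)‖ ≤ (r2 * t * H) * 2 := by
    intro x hx y hy
    have h1 := hK_le ht (hn hy) (hn hx).le
    have h2 := hK_nonneg t y x
    have h3 : 0 ≤ r2 := Real.sqrt_nonneg _
    have h4 : ‖y - (inner ℝ x y : ℝ) • x‖ ≤ 2 := by
      refine (norm_sub_le _ _).trans ?_
      rw [norm_smul, hn hx, hn hy]
      have := norm_inner_le_norm (𝕜 := ℝ) x y
      rw [hn hx, hn hy] at this
      linarith
    rw [norm_smul, Real.norm_of_nonneg (by positivity)]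
    gcongr
  have c1 := cs_inner (sphMeasure 4) ν (g := fun x => r2 • gradient u x)
    (b := fun x y => (r2 * t * hK t y x) • (y - (inner ℝ x y : ℝ) • x)) hl sph_ae hν
    cg.aestronglyMeasurable hC2 mb1.stronglyMeasurable bb1
  have f1 := (fub_inner (sphMeasure 4) ν (g := fun x => r2 • gradient u x)
    (b := fun x y => (r2 * t * hK t y x) • (y - (inner ℝ x y : ℝ) • x)) sph_ae hν
    cg.aestronglyMeasurable hC2 mb1.stronglyMeasurable bb1).1
  obtain ⟨c0a, c0b, c0c⟩ := c0
  obtain ⟨c1a, c1b, c1c⟩ := c1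
  -- left-hand side
  have eA : ∀ y ∈ sphere (0 : E 4) 1,
      (∫ x in ball (0 : E 4) 1, lap 4 u x * (2 - 2 * hK t y x))
      + (∫ x, inner ℝ (r2 • gradient u x) ((r2 * t * hK t y x) • (y - (inner ℝ x y : ℝ) • x)) ∂(sphMeasure 4))
      = 4 * Real.pi ^ 2 * ((∫ x, WK t y x * u x ∂(sphMeasure 4))
          - (1 / (2 * Real.pi ^ 2)) * ∫ x, u x ∂(sphMeasure 4)) := by
    intro y hy
    rw [← pair_A ht (hn hy) hu hN]
    congr 1
    · congr 1; funext x
      rw [inner_smul_left, inner_smul_right, inner_sub_right, inner_smul_right, grad_inner, grad_inner]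
      simp only [conj_trivial]
      linear_combination (t * hK t y x * (fderiv ℝ u x y - inner ℝ x y * fderiv ℝ u x x)) * hr2sq
  have eA' : (∫ y, (∫ x in ball (0 : E 4) 1, lap 4 u x * (2 - 2 * hK t y x)) ∂ν)
      + (∫ y, ∫ x, inner ℝ (r2 • gradient u x) ((r2 * t * hK t y x) • (y - (inner ℝ x y : ℝ) • x)) ∂(sphMeasure 4) ∂ν)
      = 4 * Real.pi ^ 2 * ((∫ y, ∫ x, WK t y x * u x ∂(sphMeasure 4) ∂ν)
          - (1 / (2 * Real.pi ^ 2)) * ∫ x, u x ∂(sphMeasure 4)) := by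
    rw [← integral_add f0 f1]
    obtain ⟨C3, hC3⟩ := (isCompact_sphere (0 : E 4) 1).exists_bound_of_continuousOn
      hu.continuous.continuousOn
    have I := WK_int ht ν hν (v := u) hu.continuous.aestronglyMeasurable hC3
    rw [integral_congr_ae (g := fun y => 4 * Real.pi ^ 2 * ((∫ x, WK t y x * u x ∂(sphMeasure 4))
          - (1 / (2 * Real.pi ^ 2)) * ∫ x, u x ∂(sphMeasure 4))) (by
        filter_upwards [hν] with y hy using eA y hy)]
    rw [integral_const_mul, integral_sub I (integrable_const _), integral_const]
    simp
  -- energy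
  have eE : (∫ x in ball (0 : E 4) 1, lap 4 u x ^ 2) + (∫ x, ‖r2 • gradient u x‖ ^ 2 ∂(sphMeasure 4))
      = (∫ x in ball (0 : E 4) 1, (lap 4 u x) ^ 2) + 2 * ∫ x, tgradNormSq 4 u x ∂(sphMeasure 4) := by
    congr 1
    · rw [← integral_const_mul]
      refine integral_congr_ae ?_
      filter_upwards [sph_ae] with x hx
      rw [tgradNormSq, hN x hx, norm_smul, mul_pow, Real.norm_eq_abs, sq_abs, sq r2, hr2sq]
      ring
  -- kernel energy
  have eB : ∀ y ∈ sphere (0 : E 4) 1,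
      (∫ z, (∫ x in ball (0 : E 4) 1, (2 - 2 * hK t z x) * (2 - 2 * hK t y x)) ∂ν)
      + (∫ z, ∫ x, inner ℝ ((r2 * t * hK t y x) • (y - (inner ℝ x y : ℝ) • x))
          ((r2 * t * hK t z x) • (z - (inner ℝ x z : ℝ) • x)) ∂(sphMeasure 4) ∂ν)
      ≤ 4 * Real.pi ^ 2 * ((∫ x, WK t y x * Phi t ν x ∂(sphMeasure 4)) + 4) := by
    intro y hy
    obtain ⟨w1, w2⟩ := WPhi ht ht2 ν hν (hn hy)
    rw [← integral_add (c0b y hy) (c1b y hy)]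
    calc _ ≤ ∫ z, 4 * Real.pi ^ 2 * ((∫ x, WK t y x * (-(1/2) * Real.log (sK t z x)) ∂(sphMeasure 4)) + 4) ∂ν := by
          refine integral_mono_ae ((c0b y hy).add (c1b y hy)) ((w1.add (integrable_const _)).const_mul _) ?_
          filter_upwards [hν] with z hz
          refine le_trans (le_of_eq ?_) (pair_B ht ht2 (hn hy) (hn hz))
          refine congrArg₂ (· + ·) ?_ ?_
          · rfl
          · refine integral_congr_ae ?_
            filter_upwards [sph_ae] with x hx
            rw [inner_smul_left, inner_smul_right, inner_sub_right, inner_sub_left, inner_sub_left,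
              inner_smul_right, inner_smul_right, inner_smul_left, inner_smul_left,
              real_inner_self_eq_norm_sq, hn hx, real_inner_comm x y, real_inner_comm z y]
            simp only [conj_trivial]
            linear_combination (t ^ 2 * hK t y x * hK t z x * (inner ℝ z y - inner ℝ x z * inner ℝ x y)) * hr2sq
      _ = _ := by
          rw [integral_const_mul, integral_add w1 (integrable_const _), w2, integral_const]
          simp
  have eB' : (∫ y, ∫ z, (∫ x in ball (0 : E 4) 1, (2 - 2 * hK t z x) * (2 - 2 * hK t y x)) ∂ν ∂ν)
      + (∫ y, ∫ z, ∫ x, inner ℝ ((r2 * t * hK t y x) • (y - (inner ℝ x y : ℝ) • x))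
          ((r2 * t * hK t z x) • (z - (inner ℝ x z : ℝ) • x)) ∂(sphMeasure 4) ∂ν ∂ν)
      ≤ 4 * Real.pi ^ 2 * ((∫ y, ∫ x, WK t y x * Phi t ν x ∂(sphMeasure 4) ∂ν) + 4) := by
    have I := WK_int ht ν hν (v := Phi t ν) (Phi_meas t ν).aestronglyMeasurable
      (fun x hx => Phi_bound ht ht2 ν hν hx)
    rw [← integral_add c0a c1a]
    calc _ ≤ ∫ y, 4 * Real.pi ^ 2 * ((∫ x, WK t y x * Phi t ν x ∂(sphMeasure 4)) + 4) ∂ν := by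
          refine integral_mono_ae (c0a.add c1a) ((I.add (integrable_const _)).const_mul _) ?_
          filter_upwards [hν] with y hy using eB y hy
      _ = _ := by
          rw [integral_const_mul, integral_add I (integrable_const _), integral_const]
          simp
  rw [← eE]
  have hlinv : 0 < l⁻¹ := by positivity
  have := mul_le_mul_of_nonneg_left eB' hlinv.le
  rw [mul_add] at this
  rw [mul_add l]
  linarith

/-! ### Part 7 : approximate identity and uniform singular integrals -/

lemma sK_ge_dist {t : ℝ} (ht : 1 < t) {y x : E 4} (hy : ‖y‖ = 1) (hx : ‖x‖ = 1) :
    ‖x - y‖ ^ 2 ≤ sK t y x := by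
  rw [sK_sph hy hx, norm_sub_sq_real, hx, hy]
  have := real_inner_le_norm x y
  rw [hx, hy] at this
  nlinarith

/-- constant in the tail bound. -/
def Dη (η : ℝ) : ℝ := (1 / (4 * Real.pi ^ 2)) * (3 * (η ^ 2)⁻¹ + 15 * ((η ^ 2)⁻¹) ^ 2)

lemma Dη_nonneg (η : ℝ) : 0 ≤ Dη η := by unfold Dη; positivity

lemma WK_tail {t : ℝ} (ht : 1 < t) (ht2 : t ≤ 2) {y x : E 4} (hy : ‖y‖ = 1) (hx : ‖x‖ = 1) {η : ℝ}
    (hη : 0 < η) (hd : η ≤ ‖x - y‖) : WK t y x ≤ (t - 1) * Dη η := by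
  have h1 : hK t y x ≤ (η ^ 2)⁻¹ := by
    unfold hK
    refine inv_anti₀ (by positivity) (le_trans ?_ (sK_ge_dist ht hy hx))
    gcongr
  have h0 := hK_nonneg t y x
  have a1 : 0 ≤ t - 1 := by linarith
  have a2 : t ^ 2 - 1 ≤ 3 * (t - 1) := by nlinarith
  have a3 : t ^ 4 - 1 ≤ 15 * (t - 1) := by
    have : t ^ 4 - 1 = (t - 1) * ((t + 1) * (t ^ 2 + 1)) := by ring
    rw [this]
    have : (t + 1) * (t ^ 2 + 1) ≤ 15 := by nlinarith
    nlinarith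
  have b1 : 0 ≤ t ^ 2 - 1 := by nlinarith
  unfold WK Dη
  calc _ ≤ (1 / (4 * Real.pi ^ 2)) * ((3 * (t - 1)) * (η ^ 2)⁻¹ + (15 * (t - 1)) * ((η ^ 2)⁻¹) ^ 2) := by
        gcongr
    _ = _ := by ring

lemma WK_approx {v : E 4 → ℝ} (hv : Continuous v) :
    ∃ t0 : ℝ, 1 < t0 ∧ ∀ t, 1 < t → t ≤ 2 → t ≤ t0 → ∀ y ∈ sphere (0 : E 4) 1,
      |(∫ x, WK t y x * v x ∂(sphMeasure 4)) - v y| ≤ 1 := by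
  obtain ⟨C, hC⟩ := (isCompact_sphere (0 : E 4) 1).exists_bound_of_continuousOn hv.continuousOn
  have huc := (isCompact_sphere (0 : E 4) 1).uniformContinuousOn_of_continuous hv.continuousOn
  rw [Metric.uniformContinuousOn_iff] at huc
  obtain ⟨η, hη, hu⟩ := huc (1/2) (by norm_num)
  have pp : 0 < Real.pi := Real.pi_pos
  set Q := 2 * |C| * Dη η * (2 * Real.pi ^ 2) with hQ
  have hQ0 : 0 ≤ Q := by have := Dη_nonneg η; positivity
  refine ⟨1 + 1 / (2 * (Q + 1)), by have : 0 < 1 / (2 * (Q + 1)) := by positivity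
                                    linarith, ?_⟩
  intro t ht ht2 htt y hy
  have hny : ‖y‖ = 1 := mem_sphere_zero_iff_norm.1 hy
  have e : (∫ x, WK t y x * v x ∂(sphMeasure 4)) - v y = ∫ x, WK t y x * (v x - v y) ∂(sphMeasure 4) := by
    have : v y = ∫ x, WK t y x * v y ∂(sphMeasure 4) := by
      rw [integral_mul_const, WK_mass ht hny, one_mul]
    have i1 : Integrable (fun x => WK t y x * v x) (sphMeasure 4) :=
      int_sph ((WK_contOn ht hny).mul hv.continuousOn)
    have i2 : Integrable (fun x => WK t y x * v y) (sphMeasure 4) :=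
      int_sph ((WK_contOn ht hny).mul continuousOn_const)
    nth_rewrite 1 [this]
    rw [← integral_sub i1 i2]
    congr 1; funext x; ring
  rw [e, ← Real.norm_eq_abs]
  have I : Integrable (fun x => WK t y x * (1/2) + 2 * |C| * ((t - 1) * Dη η)) (sphMeasure 4) :=
    int_sph (((WK_contOn ht hny).mul continuousOn_const).add continuousOn_const)
  refine (norm_integral_le_of_norm_le I ?_).trans ?_
  · filter_upwards [sph_ae] with x hx
    have hnx : ‖x‖ = 1 := mem_sphere_zero_iff_norm.1 hx
    have w0 := WK_nonneg ht y x
    have d0 := Dη_nonneg η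
    have t0 : 0 ≤ t - 1 := by linarith
    rw [norm_mul, Real.norm_of_nonneg w0]
    by_cases hd : ‖x - y‖ < η
    · have := (hu x hx y hy (by rwa [dist_eq_norm])).le
      rw [Real.dist_eq] at this
      have h2 : 0 ≤ 2 * |C| * ((t - 1) * Dη η) := by positivity
      have h3 := mul_le_mul_of_nonneg_left this w0
      rw [Real.norm_eq_abs]
      linarith
    · have h1 := WK_tail ht ht2 hny hnx hη (not_lt.1 hd)
      have h2 : ‖v x - v y‖ ≤ 2 * |C| := by
        have := norm_sub_le (v x) (v y)
        have := hC x hx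
        have := hC y hy
        have := le_abs_self C
        linarith
      have h3 : WK t y x * ‖v x - v y‖ ≤ ((t - 1) * Dη η) * (2 * |C|) := by gcongr
      linarith
  · have i2 : Integrable (fun x => WK t y x * (1/2)) (sphMeasure 4) :=
      int_sph ((WK_contOn ht hny).mul continuousOn_const)
    rw [integral_add i2 (integrable_const _),
      integral_mul_const, WK_mass ht hny, integral_const, sph_univ, smul_eq_mul]
    have : 2 * Real.pi ^ 2 * (2 * |C| * ((t - 1) * Dη η)) = (t - 1) * Q := by rw [hQ]; ring
    rw [this]
    have h4 : (t - 1) * Q ≤ 1 / (2 * (Q + 1)) * Q := by gcongr; linarith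
    have h5 : 1 / (2 * (Q + 1)) * Q ≤ 1 / 2 := by
      rw [div_mul_eq_mul_div, div_le_div_iff₀ (by positivity) (by norm_num)]
      linarith
    linarith

lemma sK_symm {t : ℝ} {y x : E 4} (hy : ‖y‖ = 1) (hx : ‖x‖ = 1) : sK t y x = sK t x y := by
  rw [sK_sph hy hx, sK_sph hx hy, real_inner_comm]

/-- Uniform bound for the singular integral. -/
lemma sing_bound {p : ℝ} (hp : 0 < p) (hp3 : p < 3) :
    ∃ M : ℝ, 0 < M ∧ ∀ t, 1 < t → t ≤ 2 → ∀ x ∈ sphere (0 : E 4) 1,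
      ∫ z, Real.exp (p * (-(1/2) * Real.log (sK t z x))) ∂(sphMeasure 4) ≤ M := by
  set k : E 4 → ℝ := fun w => ‖w‖ ^ (-(p + 1)) with hk
  have hkm : Measurable k := by rw [hk]; fun_prop
  have hki : IntegrableOn k (ball 0 4) := by
    refine integrableOn_ball_of_norm_le_rpow (C := 1) (α := p + 1) (by simp) (by simp; linarith)
      (ae_of_all _ fun x => ?_) hkm.aestronglyMeasurable
    rw [hk, Real.norm_of_nonneg (by positivity), one_mul]
  have hkn : ∀ w, 0 ≤ k w := fun w => by rw [hk]; positivity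
  have hkI : Integrable ((ball (0 : E 4) 4).indicator k) := hki.integrable_indicator measurableSet_ball
  refine ⟨15 * (∫ w, (ball (0 : E 4) 4).indicator k w) + 1, ?_, ?_⟩
  · have : 0 ≤ ∫ w, (ball (0 : E 4) 4).indicator k w :=
      integral_nonneg fun w => Set.indicator_nonneg (fun w _ => hkn w) w
    positivity
  intro t ht ht2 x hx
  have hnx : ‖x‖ = 1 := mem_sphere_zero_iff_norm.1 hx
  set G : E 4 → ℝ := fun z => Real.exp (p * (-(1/2) * Real.log (sK t x z))) with hG
  have e1 : ∫ z, Real.exp (p * (-(1/2) * Real.log (sK t z x))) ∂(sphMeasure 4)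
      = ∫ z, G z ∂(sphMeasure 4) := by
    refine integral_congr_ae ?_
    filter_upwards [sph_ae] with z hz
    rw [sK_symm (mem_sphere_zero_iff_norm.1 hz) hnx]
  have hGc : ContDiffOn ℝ 1 G (ball 0 t) :=
    (contDiffOn_const.mul (contDiffOn_const.mul ((sK_contDiff t x 1).contDiffOn.log
      fun z hz => (sK_pos ht hnx hz).ne'))).exp
  obtain ⟨G', hG', he⟩ := extend_fn ht (n := 1) G hGc
  have e2 : ∫ z, G z ∂(sphMeasure 4) = ∫ z in ball (0 : E 4) 1, (4 * G' z + fderiv ℝ G' z z) := by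
    rw [← sph_eq_ball G' hG']
    refine integral_congr_ae ?_
    filter_upwards [sph_ae] with z hz
    exact (he z (sphere_subset_closedBall hz)).eq_of_nhds.symm
  rw [e1, e2]
  have hIk : IntegrableOn (fun z => 15 * (ball (0 : E 4) 4).indicator k (z - t • x)) (ball 0 1) :=
    ((hkI.comp_sub_right (t • x)).const_mul 15).integrableOn
  calc _ ≤ ∫ z in ball (0 : E 4) 1, 15 * (ball (0 : E 4) 4).indicator k (z - t • x) := by
        refine setIntegral_mono_on ?_ hIk measurableSet_ball ?_
        · exact int_ball ((continuous_const.mul hG'.continuous).add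
            ((hG'.continuous_fderiv (by norm_num)).clm_apply continuous_id)).continuousOn
        · intro z hz
          have hzt : z ∈ ball (0 : E 4) t := ball_subset_ball ht.le hz
          have hzn : ‖z‖ ≤ 1 := by simpa using (ball_subset_closedBall hz)
          have ez := he z (ball_subset_closedBall hz)
          rw [ez.fderiv_eq, ez.eq_of_nhds]
          have spos := sK_pos ht hnx hzt
          have hd : HasFDerivAt G _ z :=
            ((((sK_hasFDeriv t x z).log spos.ne').const_mul (-(1/2))).const_mul p).exp
          rw [hd.fderiv]
          set ρ := ‖z - t • x‖ with hρ
          have hs : sK t x z = ρ ^ 2 := rfl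
          have ρpos : 0 < ρ := by
            rcases (norm_nonneg (z - t • x)).lt_or_eq with h | h
            · exact h
            · rw [hs, hρ, ← h] at spos; norm_num at spos
          have ρ3 : ρ ≤ 3 := by
            have := sK_le_nine ht ht2 hnx hzn
            rw [hs] at this
            nlinarith
          have hGz : G z = ρ ^ (-p) := by
            rw [hG, Real.rpow_def_of_pos ρpos]
            simp only [hs, Real.log_pow]
            congr 1; push_cast; ring
          have hkz : (ball (0 : E 4) 4).indicator k (z - t • x) = G z * ρ⁻¹ := by
            rw [Set.indicator_of_mem (by rw [mem_ball_zero_iff]; linarith), hGz, hk]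
            simp only
            rw [← hρ, neg_add, Real.rpow_add ρpos, Real.rpow_neg_one]
          rw [hkz]
          have hGp : 0 < G z := Real.exp_pos _
          have hin : -(inner ℝ (z - t • x) z : ℝ) ≤ ρ := by
            have h1 := neg_le_of_abs_le (abs_real_inner_le_norm (z - t • x) z)
            have h2 : ‖z - t • x‖ * ‖z‖ ≤ ρ * 1 := by gcongr
            linarith
          simp only [_root_.smul_apply, innerSL_apply_apply, smul_eq_mul]
          change 4 * G z + G z * _ ≤ _
          rw [hs]
          have key : p * (-(1/2) * ((ρ ^ 2)⁻¹ * (2 * inner ℝ (z - t • x) z))) ≤ 3 * ρ⁻¹ := by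
            have : p * (-(1/2) * ((ρ ^ 2)⁻¹ * (2 * inner ℝ (z - t • x) z)))
                = p * (ρ ^ 2)⁻¹ * (-(inner ℝ (z - t • x) z : ℝ)) := by ring
            rw [this]
            calc _ ≤ p * (ρ ^ 2)⁻¹ * ρ := by gcongr
              _ = p * ρ⁻¹ := by field_simp
              _ ≤ _ := by gcongr
          have k2 : 4 ≤ 12 * ρ⁻¹ := by
            rw [← div_eq_mul_inv, le_div_iff₀ ρpos]; linarith
          have := mul_le_mul_of_nonneg_left key hGp.le
          have := mul_le_mul_of_nonneg_left k2 hGp.le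
          linarith
    _ ≤ ∫ z, 15 * (ball (0 : E 4) 4).indicator k (z - t • x) := by
        refine setIntegral_le_integral ((hkI.comp_sub_right (t • x)).const_mul 15) (ae_of_all _ fun z => ?_)
        have := Set.indicator_nonneg (s := ball (0 : E 4) 4) (fun w _ => hkn w) (z - t • x)
        simp only [Pi.zero_apply]; positivity
    _ = 15 * ∫ w, (ball (0 : E 4) 4).indicator k w := by
        rw [integral_const_mul, integral_sub_right_eq_self (fun w => (ball (0 : E 4) 4).indicator k w)]
    _ ≤ _ := by linarith

/-! ### Part 8 : the tangential gradient depends only on boundary values -/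

lemma fderiv_tang {u f : E 4 → ℝ} (hu : Differentiable ℝ u) (hf : Differentiable ℝ f)
    (h : ∀ x ∈ sphere (0 : E 4) 1, u x = f x) {x w : E 4} (hx : ‖x‖ = 1)
    (hxw : (inner ℝ x w : ℝ) = 0) : fderiv ℝ u x w = fderiv ℝ f x w := by
  by_cases hw0 : w = 0
  · simp [hw0]
  have hwn : ‖w‖ ≠ 0 := norm_ne_zero_iff.2 hw0
  set e : E 4 := ‖w‖⁻¹ • w with he
  have hwe : w = ‖w‖ • e := by rw [he, smul_smul, mul_inv_cancel₀ hwn, one_smul]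
  have hen : ‖e‖ = 1 := by rw [he, norm_smul, norm_inv, norm_norm, inv_mul_cancel₀ hwn]
  have hxe : (inner ℝ x e : ℝ) = 0 := by rw [he, inner_smul_right, hxw, mul_zero]
  let γ : ℝ → E 4 := fun s => Real.cos s • x + Real.sin s • e
  have hγ0 : γ 0 = x := by simp [γ]
  have hγS : ∀ s, γ s ∈ sphere (0 : E 4) 1 := by
    intro s
    rw [mem_sphere_zero_iff_norm]
    have : ‖γ s‖ ^ 2 = 1 := by
      simp only [γ]
      rw [norm_add_sq_real, norm_smul, norm_smul, inner_smul_left, inner_smul_right, hxe, hx, hen]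
      simp
    nlinarith [norm_nonneg (γ s)]
  have hγd : HasDerivAt γ e 0 := by
    have h1 := ((Real.hasDerivAt_cos 0).smul_const x).add ((Real.hasDerivAt_sin 0).smul_const e)
    simp at h1
    exact h1
  have key : ∀ g : E 4 → ℝ, Differentiable ℝ g → HasDerivAt (g ∘ γ) (fderiv ℝ g x e) 0 := by
    intro g hg
    have := (hg (γ 0)).hasFDerivAt.comp_hasDerivAt 0 hγd
    rwa [hγ0] at this
  have h2 : u ∘ γ = f ∘ γ := by
    funext s; exact h _ (hγS s)
  have h3 := key u hu
  rw [h2] at h3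
  have h4 := h3.unique (key f hf)
  clear_value e
  rw [hwe, map_smul, map_smul, h4]

lemma tgrad_eq {u f : E 4 → ℝ} (hu : Differentiable ℝ u) (hf : Differentiable ℝ f)
    (h : ∀ x ∈ sphere (0 : E 4) 1, u x = f x) {x : E 4} (hx : ‖x‖ = 1) :
    tgradNormSq 4 f x = tgradNormSq 4 u x := by
  set g := gradient u x - gradient f x with hg
  set c : ℝ := inner ℝ g x with hc
  have hxx : (inner ℝ x x : ℝ) = 1 := by rw [real_inner_self_eq_norm_sq, hx]; norm_num
  have hperp : (inner ℝ x (g - c • x) : ℝ) = 0 := by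
    rw [inner_sub_right, inner_smul_right, hxx, hc, real_inner_comm]; ring
  have h1 : (inner ℝ g (g - c • x) : ℝ) = 0 := by
    rw [hg, inner_sub_left, grad_inner, grad_inner, ← hg, fderiv_tang hu hf h hx hperp, sub_self]
  have h2 : (inner ℝ (g - c • x) (g - c • x) : ℝ) = 0 := by
    rw [inner_sub_left, h1, inner_smul_left, hperp]; simp
  have h3 : g - c • x = 0 := inner_self_eq_zero.1 h2
  have h4 : gradient u x = gradient f x + c • x := by
    rw [← sub_eq_zero, ← h3, hg]; abel
  unfold tgradNormSq
  rw [← grad_inner, ← grad_inner, h4, norm_add_sq_real, inner_add_left, inner_smul_right,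
    inner_smul_left, hxx, norm_smul, hx]
  simp
  ring

lemma tgrad_nonneg (u : E 4 → ℝ) {x : E 4} (hx : ‖x‖ = 1) : 0 ≤ tgradNormSq 4 u x := by
  unfold tgradNormSq
  rw [← grad_inner]
  have h := abs_real_inner_le_norm (gradient u x) x
  rw [hx, mul_one] at h
  have := sq_le_sq' (by linarith [abs_le.1 h]) (abs_le.1 h).2
  linarith

lemma tgrad_int_eq {u f : E 4 → ℝ} (hu : Differentiable ℝ u) (hf : Differentiable ℝ f)
    (h : ∀ x ∈ sphere (0 : E 4) 1, u x = f x) :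
    ∫ x, tgradNormSq 4 f x ∂(sphMeasure 4) = ∫ x, tgradNormSq 4 u x ∂(sphMeasure 4) := by
  refine integral_congr_ae ?_
  filter_upwards [sph_ae] with x hx
  exact tgrad_eq hu hf h (mem_sphere_zero_iff_norm.1 hx)

lemma energy_nonneg (u : E 4 → ℝ) :
    0 ≤ (∫ x in ball (0 : E 4) 1, (lap 4 u x) ^ 2) + 2 * ∫ x, tgradNormSq 4 u x ∂(sphMeasure 4) := by
  have h1 : 0 ≤ ∫ x in ball (0 : E 4) 1, (lap 4 u x) ^ 2 := integral_nonneg fun x => sq_nonneg _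
  have h2 : 0 ≤ ∫ x, tgradNormSq 4 u x ∂(sphMeasure 4) := by
    refine integral_nonneg_of_ae ?_
    filter_upwards [sph_ae] with x hx
    exact tgrad_nonneg u (mem_sphere_zero_iff_norm.1 hx)
  linarith

/-! ### Part 9 : Gibbs variational bounds -/

/-- normalized restriction of `e^{3u} dσ` to `Ω`. -/
def tnu (u : E 4 → ℝ) (Ω : Set (E 4)) : Measure (E 4) :=
  ((sphMeasure 4).restrict Ω).tilted (fun x => 3 * u x)

/-- mass of `Ω`. -/
def tZ (u : E 4 → ℝ) (Ω : Set (E 4)) : ℝ := ∫ x in Ω, Real.exp (3 * u x) ∂(sphMeasure 4)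

/-- relative entropy. -/
def tEnt (u : E 4 → ℝ) (Ω : Set (E 4)) : ℝ := 3 * (∫ x, u x ∂(tnu u Ω)) - Real.log (tZ u Ω)

lemma exp_int {u : E 4 → ℝ} (hu : Continuous u) :
    Integrable (fun x => Real.exp (3 * u x)) (sphMeasure 4) :=
  int_sph (by fun_prop)

lemma tnu_ac (u : E 4 → ℝ) (Ω : Set (E 4)) : tnu u Ω ≪ sphMeasure 4 :=
  (tilted_absolutelyContinuous _ _).trans Measure.absolutelyContinuous_restrict

lemma tnu_prob {u : E 4 → ℝ} (hu : Continuous u) {Ω : Set (E 4)} (hZ : 0 < tZ u Ω) :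
    IsProbabilityMeasure (tnu u Ω) := by
  have : NeZero ((sphMeasure 4).restrict Ω) := by
    refine ⟨fun h => ?_⟩
    unfold tZ at hZ
    rw [h] at hZ
    simp at hZ
  exact isProbabilityMeasure_tilted (exp_int hu).restrict

lemma tnu_sph (u : E 4 → ℝ) (Ω : Set (E 4)) : ∀ᵐ y ∂(tnu u Ω), y ∈ sphere (0 : E 4) 1 :=
  (tnu_ac u Ω).ae_le sph_ae

lemma tnu_mem (u : E 4 → ℝ) {Ω : Set (E 4)} (hΩ : MeasurableSet Ω) : ∀ᵐ y ∂(tnu u Ω), y ∈ Ω :=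
  (tilted_absolutelyContinuous _ _).ae_le (ae_restrict_mem hΩ)

lemma tnu_integral (u : E 4 → ℝ) (Ω : Set (E 4)) (g : E 4 → ℝ) :
    ∫ x, g x ∂(tnu u Ω) = ∫ x in Ω, Real.exp (3 * u x) / tZ u Ω * g x ∂(sphMeasure 4) := by
  unfold tnu tZ
  rw [integral_tilted]
  rfl

lemma gibbs {u : E 4 → ℝ} (hu : Continuous u) {Ω : Set (E 4)} (hZ : 0 < tZ u Ω)
    {X : E 4 → ℝ} (hX : ContinuousOn X (sphere (0 : E 4) 1)) {M : ℝ} (hM0 : 0 < M)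
    (hM : ∫ x, Real.exp (X x) ∂(sphMeasure 4) ≤ M) :
    ∫ x, X x ∂(tnu u Ω) ≤ tEnt u Ω + Real.log M := by
  set Z := tZ u Ω with hZd
  have huS : ContinuousOn u (sphere (0 : E 4) 1) := hu.continuousOn
  have i1 : Integrable (fun x => Real.exp (3 * u x) / Z * X x) ((sphMeasure 4).restrict Ω) :=
    (int_sph (by fun_prop)).restrict
  have i2 : Integrable (fun x => Real.exp (3 * u x) / Z * (3 * u x)) ((sphMeasure 4).restrict Ω) :=
    (int_sph (by fun_prop)).restrict
  have i3 : Integrable (fun x => Real.exp (3 * u x) / Z) ((sphMeasure 4).restrict Ω) :=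
    (int_sph (by fun_prop)).restrict
  have i4' : Integrable (fun x => Real.exp (X x) / M) (sphMeasure 4) := int_sph (by fun_prop)
  have i4 : Integrable (fun x => Real.exp (X x) / M) ((sphMeasure 4).restrict Ω) := i4'.restrict
  have e1 : ∫ x in Ω, Real.exp (3 * u x) / Z ∂(sphMeasure 4) = 1 := by
    rw [integral_div]
    exact div_self hZ.ne'
  have e2 : ∫ x in Ω, Real.exp (X x) / M ∂(sphMeasure 4) ≤ 1 := by
    calc _ ≤ ∫ x, Real.exp (X x) / M ∂(sphMeasure 4) :=
          setIntegral_le_integral i4' (Eventually.of_forall fun x => by positivity)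
      _ ≤ 1 := by rw [integral_div]; exact (div_le_one hM0).2 hM
  have e3 : ∫ x in Ω, Real.exp (3 * u x) / Z * (3 * u x) ∂(sphMeasure 4) =
      3 * ∫ x, u x ∂(tnu u Ω) := by
    rw [tnu_integral, ← integral_const_mul]
    congr 1; funext x; ring
  have key : ∫ x in Ω, Real.exp (3 * u x) / Z * X x ∂(sphMeasure 4) ≤
      ∫ x in Ω, (Real.exp (3 * u x) / Z * (3 * u x) + (Real.log M - Real.log Z - 1) *
        (Real.exp (3 * u x) / Z) + Real.exp (X x) / M) ∂(sphMeasure 4) := by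
    refine integral_mono i1 ((i2.add (i3.const_mul _)).add i4) fun x => ?_
    have h1 := Real.add_one_le_exp (X x - 3 * u x + Real.log Z - Real.log M)
    have h2 : Real.exp (3 * u x) / Z * Real.exp (X x - 3 * u x + Real.log Z - Real.log M)
        = Real.exp (X x) / M := by
      rw [Real.exp_sub, Real.exp_add, Real.exp_sub, Real.exp_log hZ, Real.exp_log hM0]
      have := (Real.exp_pos (3 * u x)).ne'
      field_simp
    have h3 : 0 ≤ Real.exp (3 * u x) / Z := by positivity
    have h4 := mul_le_mul_of_nonneg_left h1 h3
    rw [h2] at h4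
    simp only
    linarith
  have i23 : Integrable (fun x => Real.exp (3 * u x) / Z * (3 * u x) + (Real.log M - Real.log Z - 1) *
        (Real.exp (3 * u x) / Z)) ((sphMeasure 4).restrict Ω) := i2.add (i3.const_mul _)
  rw [integral_add i23 i4, integral_add i2 (i3.const_mul _), integral_const_mul, e1, e3] at key
  rw [tnu_integral, tEnt, ← hZd]
  linarith

/-- Upper bound for the potential of `tnu u Ω` on the sphere. -/
lemma Phi_tnu_le {p M : ℝ} (hp : 0 < p) (hM0 : 0 < M)
    {t : ℝ} (ht : 1 < t)
    (hM : ∀ x ∈ sphere (0 : E 4) 1,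
      ∫ z, Real.exp (p * (-(1 / 2) * Real.log (sK t z x))) ∂(sphMeasure 4) ≤ M)
    {u : E 4 → ℝ} (hu : Continuous u) {Ω : Set (E 4)} (hZ : 0 < tZ u Ω)
    {x : E 4} (hx : x ∈ sphere (0 : E 4) 1) :
    Phi t (tnu u Ω) x ≤ (tEnt u Ω + Real.log M) / p := by
  have hx1 := mem_sphere_zero_iff_norm.1 hx
  have hc : ContinuousOn (fun z => p * (-(1 / 2) * Real.log (sK t z x))) (sphere (0 : E 4) 1) := by
    refine ContinuousOn.congr (f := fun z => p * (-(1 / 2) * Real.log (sK t x z)))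
      (continuousOn_const.mul (logs_contS ht hx1)) fun z hz => ?_
    simp only
    rw [sK_symm (mem_sphere_zero_iff_norm.1 hz) hx1]
  have := gibbs hu hZ hc hM0 (hM x hx)
  rw [integral_const_mul] at this
  rw [le_div_iff₀ hp, mul_comm]
  exact this

lemma WPhi_self {t : ℝ} (ht : 1 < t) (ht2 : t ≤ 2) (ν : Measure (E 4)) [IsFiniteMeasure ν]
    (hν : ∀ᵐ y ∂ν, y ∈ sphere (0 : E 4) 1) {e : ℝ}
    (he : ∀ x ∈ sphere (0 : E 4) 1, Phi t ν x ≤ e) {y : E 4} (hy : ‖y‖ = 1) :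
    Integrable (fun x => WK t y x * Phi t ν x) (sphMeasure 4) ∧
    ∫ x, WK t y x * Phi t ν x ∂(sphMeasure 4) ≤ e := by
  have iW : Integrable (WK t y) (sphMeasure 4) := int_sph (WK_contOn ht hy)
  have i1 : Integrable (fun x => WK t y x * Phi t ν x) (sphMeasure 4) := by
    refine iW.mul_bdd (c := (|Real.log ((t - 1) ^ 2)| + |Real.log 9|) * ν.real Set.univ)
      (Phi_meas t ν).aestronglyMeasurable ?_
    filter_upwards [sph_ae] with x hx
    exact Phi_bound ht ht2 ν hν hx
  refine ⟨i1, ?_⟩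
  calc _ ≤ ∫ x, WK t y x * e ∂(sphMeasure 4) := by
        refine integral_mono_ae i1 (iW.mul_const _) ?_
        filter_upwards [sph_ae] with x hx
        exact mul_le_mul_of_nonneg_left (he x hx) (WK_nonneg ht y x)
    _ = e := by rw [integral_mul_const, WK_mass ht hy, one_mul]

lemma WPhi_cross {t : ℝ} (ht : 1 < t) (ht2 : t ≤ 2) (ν : Measure (E 4)) [IsProbabilityMeasure ν]
    (hν : ∀ᵐ y ∂ν, y ∈ sphere (0 : E 4) 1) {e : ℝ}
    (he : ∀ x ∈ sphere (0 : E 4) 1, Phi t ν x ≤ e) {y : E 4} (hy : ‖y‖ = 1) {r : ℝ} (hr : 0 < r)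
    (hsep : ∀ᵐ z ∂ν, r ≤ ‖y - z‖) (hsmall : (t - 1) * (Dη (r / 2) * |e| * (2 * Real.pi ^ 2)) ≤ 1) :
    ∫ x, WK t y x * Phi t ν x ∂(sphMeasure 4) ≤ |Real.log (r / 2)| + 1 := by
  have iW : Integrable (WK t y) (sphMeasure 4) := int_sph (WK_contOn ht hy)
  have i1 := (WPhi_self ht ht2 ν hν he hy).1
  set L := |Real.log (r / 2)| with hL
  have hL0 : 0 ≤ L := abs_nonneg _
  calc _ ≤ ∫ x, (WK t y x * L + (t - 1) * Dη (r / 2) * |e|) ∂(sphMeasure 4) := by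
        refine integral_mono_ae i1 ((iW.mul_const _).add (integrable_const _)) ?_
        filter_upwards [sph_ae] with x hx
        have hx1 := mem_sphere_zero_iff_norm.1 hx
        have hW := WK_nonneg ht y x
        have hD : 0 ≤ (t - 1) * Dη (r / 2) := mul_nonneg (by linarith) (Dη_nonneg _)
        by_cases hd : r / 2 ≤ ‖x - y‖
        · have h1 := WK_tail ht ht2 hy hx1 (by linarith : 0 < r / 2) hd
          have h2 : Phi t ν x ≤ |e| := (he x hx).trans (le_abs_self e)
          calc WK t y x * Phi t ν x ≤ WK t y x * |e| := mul_le_mul_of_nonneg_left h2 hW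
            _ ≤ (t - 1) * Dη (r / 2) * |e| := mul_le_mul_of_nonneg_right h1 (abs_nonneg _)
            _ ≤ _ := by have := mul_nonneg hW hL0; linarith
        · push Not at hd
          have h2 : Phi t ν x ≤ L := by
            have h3 : Phi t ν x ≤ ∫ z, L ∂ν := by
              refine integral_mono_ae ?_ (integrable_const _) ?_
              · refine Integrable.of_bound (C := |Real.log ((t - 1) ^ 2)| + |Real.log 9|) ?_ ?_
                · exact ((logs_meas t).comp (measurable_const.prodMk measurable_id)).aestronglyMeasurable
                · filter_upwards [hν] with z hz
                  exact logs_bound ht ht2 (mem_sphere_zero_iff_norm.1 hz) hx1.le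
              · filter_upwards [hν, hsep] with z hz hs
                have hz1 := mem_sphere_zero_iff_norm.1 hz
                have h4 : r / 2 ≤ ‖x - z‖ := by
                  have : ‖y - z‖ ≤ ‖x - y‖ + ‖x - z‖ := by
                    rw [← norm_neg (x - y)]
                    calc ‖y - z‖ = ‖-(x - y) + (x - z)‖ := by congr 1; abel
                      _ ≤ _ := norm_add_le _ _
                  linarith
                have h5 := sK_ge_dist ht hz1 hx1
                have h6 : (r / 2) ^ 2 ≤ sK t z x := le_trans (by gcongr) h5
                have h7 := Real.log_le_log (by positivity) h6
                rw [Real.log_pow] at h7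
                have h8 := neg_abs_le (Real.log (r / 2))
                rw [← hL] at h8
                push_cast at h7
                linarith
            simpa using h3
          have h3 := mul_le_mul_of_nonneg_left h2 hW
          have := mul_nonneg hD (abs_nonneg e)
          linarith
    _ = L + (t - 1) * (Dη (r / 2) * |e| * (2 * Real.pi ^ 2)) := by
        rw [integral_add (iW.mul_const _) (integrable_const _), integral_mul_const, WK_mass ht hy, integral_const, sph_univ, smul_eq_mul]
        ring
    _ ≤ _ := by linarith

/-! ### Part 10 : assembling the inequality for separated sets of large mass -/

/-- average of finitely many measures. -/
def avg {n : ℕ} (ν : Fin n → Measure (E 4)) : Measure (E 4) := (n : ℝ≥0∞)⁻¹ • ∑ i, ν i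

lemma avg_integral {n : ℕ} (ν : Fin n → Measure (E 4)) {g : E 4 → ℝ}
    (hg : ∀ i, Integrable g (ν i)) : ∫ x, g x ∂(avg ν) = (n : ℝ)⁻¹ * ∑ i, ∫ x, g x ∂(ν i) := by
  unfold avg
  rw [integral_smul_measure, integral_finsetSum_measure (fun i _ => hg i)]
  simp

lemma avg_prob {n : ℕ} (hn : 0 < n) (ν : Fin n → Measure (E 4)) [∀ i, IsProbabilityMeasure (ν i)] :
    IsProbabilityMeasure (avg ν) := by
  refine ⟨?_⟩
  unfold avg
  rw [Measure.smul_apply, Measure.finsetSum_apply]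
  simp
  exact ENNReal.inv_mul_cancel (by exact_mod_cast hn.ne') (ENNReal.natCast_ne_top n)

lemma avg_ac {n : ℕ} (ν : Fin n → Measure (E 4)) {μ : Measure (E 4)} (h : ∀ i, ν i ≪ μ) :
    avg ν ≪ μ := by
  intro s hs
  unfold avg
  rw [Measure.smul_apply, Measure.finsetSum_apply, Finset.sum_eq_zero (fun i _ => h i hs)]
  simp

lemma logs_int {t : ℝ} (ht : 1 < t) (ht2 : t ≤ 2) (ν : Measure (E 4)) [IsFiniteMeasure ν]
    (hν : ∀ᵐ y ∂ν, y ∈ sphere (0 : E 4) 1) {x : E 4} (hx1 : ‖x‖ = 1) :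
    Integrable (fun z => -(1 / 2) * Real.log (sK t z x)) ν := by
  refine Integrable.of_bound (C := |Real.log ((t - 1) ^ 2)| + |Real.log 9|) ?_ ?_
  · exact ((logs_meas t).comp (measurable_const.prodMk measurable_id)).aestronglyMeasurable
  · filter_upwards [hν] with z hz
    exact logs_bound ht ht2 (mem_sphere_zero_iff_norm.1 hz) hx1.le

lemma kappa_bound {n : ℕ} (hn : 0 < n) {t : ℝ} (ht : 1 < t) (ht2 : t ≤ 2)
    (ν : Fin n → Measure (E 4)) [∀ i, IsProbabilityMeasure (ν i)]
    (hν : ∀ i, ∀ᵐ y ∂(ν i), y ∈ sphere (0 : E 4) 1)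
    (Ω : Fin n → Set (E 4)) (hνΩ : ∀ i, ∀ᵐ y ∂(ν i), y ∈ Ω i) {r : ℝ} (hr : 0 < r)
    (hsep : ∀ i j, i ≠ j → ∀ x ∈ Ω i, ∀ y ∈ Ω j, r ≤ ‖x - y‖) (e : Fin n → ℝ)
    (he : ∀ i, ∀ x ∈ sphere (0 : E 4) 1, Phi t (ν i) x ≤ e i)
    (hsmall : ∀ i, (t - 1) * (Dη (r / 2) * |e i| * (2 * Real.pi ^ 2)) ≤ 1) :
    (∫ y, (∫ x, WK t y x * Phi t (avg ν) x ∂(sphMeasure 4)) ∂(avg ν)) ≤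
      (n : ℝ)⁻¹ * ((n : ℝ)⁻¹ * ∑ i, e i) + (|Real.log (r / 2)| + 1) := by
  set L := |Real.log (r / 2)| + 1 with hL
  have hL0 : 0 ≤ L := by positivity
  have hn0 : (0 : ℝ) < n := by exact_mod_cast hn
  have := avg_prob hn ν
  have hPhi : ∀ x ∈ sphere (0 : E 4) 1, Phi t (avg ν) x = (n : ℝ)⁻¹ * ∑ j, Phi t (ν j) x := by
    intro x hx
    exact avg_integral ν (fun i => logs_int ht ht2 (ν i) (hν i) (mem_sphere_zero_iff_norm.1 hx))
  have havS : ∀ᵐ y ∂(avg ν), y ∈ sphere (0 : E 4) 1 := by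
    change avg ν (sphere (0 : E 4) 1)ᶜ = 0
    unfold avg
    have h0 : ∀ i, (ν i) (sphere (0 : E 4) 1)ᶜ = 0 := fun i => hν i
    rw [Measure.smul_apply, Measure.finsetSum_apply, Finset.sum_eq_zero (fun i _ => h0 i)]
    simp
  have hI : ∀ i, Integrable (fun y => ∫ x, WK t y x * Phi t (avg ν) x ∂(sphMeasure 4)) (ν i) :=
    fun i => WK_int ht (ν i) (hν i) (Phi_meas t (avg ν)).aestronglyMeasurable
      (fun x hx => Phi_bound ht ht2 (avg ν) havS hx)
  rw [avg_integral ν hI]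
  have hpt : ∀ i, ∫ y, (∫ x, WK t y x * Phi t (avg ν) x ∂(sphMeasure 4)) ∂(ν i) ≤
      (n : ℝ)⁻¹ * e i + L := by
    intro i
    have h1 : ∫ y, (∫ x, WK t y x * Phi t (avg ν) x ∂(sphMeasure 4)) ∂(ν i) ≤
        ∫ y, ((n : ℝ)⁻¹ * e i + L) ∂(ν i) := by
      refine integral_mono_ae (hI i) (integrable_const _) ?_
      filter_upwards [hν i, hνΩ i] with y hy hyΩ
      have hy1 := mem_sphere_zero_iff_norm.1 hy
      have h2 : ∫ x, WK t y x * Phi t (avg ν) x ∂(sphMeasure 4) =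
          (n : ℝ)⁻¹ * ∑ j, ∫ x, WK t y x * Phi t (ν j) x ∂(sphMeasure 4) := by
        rw [← integral_finsetSum _ (fun j _ => (WPhi_self ht ht2 (ν j) (hν j) (he j) hy1).1),
          ← integral_const_mul]
        refine integral_congr_ae ?_
        filter_upwards [sph_ae] with x hx
        rw [hPhi x hx, Finset.mul_sum, Finset.mul_sum, Finset.mul_sum]
        refine Finset.sum_congr rfl fun j _ => by ring
      have h3 : ∑ j, ∫ x, WK t y x * Phi t (ν j) x ∂(sphMeasure 4) ≤
          ∑ j, ((if j = i then e i else 0) + L) := by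
        refine Finset.sum_le_sum fun j _ => ?_
        by_cases hj : j = i
        · subst hj
          have := (WPhi_self ht ht2 (ν j) (hν j) (he j) hy1).2
          simp only [if_true]; linarith
        · rw [if_neg hj, zero_add]
          refine WPhi_cross ht ht2 (ν j) (hν j) (he j) hy1 hr ?_ (hsmall j)
          filter_upwards [hνΩ j] with z hz
          exact hsep i j (Ne.symm hj) y hyΩ z hz
      rw [h2]
      have h4 := mul_le_mul_of_nonneg_left h3 (inv_nonneg.2 hn0.le)
      refine h4.trans (le_of_eq ?_)
      rw [Finset.sum_add_distrib]
      simp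
      field_simp
    simpa using h1
  calc _ ≤ (n : ℝ)⁻¹ * ∑ i, ((n : ℝ)⁻¹ * e i + L) :=
        mul_le_mul_of_nonneg_left (Finset.sum_le_sum fun i _ => hpt i) (inv_nonneg.2 hn0.le)
    _ = _ := by
        rw [Finset.sum_add_distrib, ← Finset.mul_sum]
        simp
        field_simp

lemma assembly {n : ℕ} (hn : 0 < n) {p M θ r : ℝ} (hp : 0 < p) (hM0 : 0 < M)
    (hM : ∀ t, 1 < t → t ≤ 2 → ∀ x ∈ sphere (0 : E 4) 1,
      ∫ z, Real.exp (p * (-(1 / 2) * Real.log (sK t z x))) ∂(sphMeasure 4) ≤ M)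
    (hθ : 0 < θ) (hr : 0 < r) {u : E 4 → ℝ} (hu : ContDiff ℝ 2 u)
    (hN : ∀ x ∈ sphere (0 : E 4) 1, fderiv ℝ u x x = 0)
    (Ω : Fin n → Set (E 4)) (hΩ : ∀ i, MeasurableSet (Ω i))
    (hsep : ∀ i j, i ≠ j → ∀ x ∈ Ω i, ∀ y ∈ Ω j, r ≤ ‖x - y‖)
    (hZ : ∀ i, θ * (∫ x, Real.exp (3 * u x) ∂(sphMeasure 4)) ≤ tZ u (Ω i)) :
    Real.log (∫ x, Real.exp (3 * u x) ∂(sphMeasure 4)) -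
        3 * ((1 / (2 * Real.pi ^ 2)) * ∫ x, u x ∂(sphMeasure 4)) ≤
      9 / (16 * Real.pi ^ 2 * n * p) * ((∫ x in ball (0 : E 4) 1, (lap 4 u x) ^ 2) +
        2 * ∫ x, tgradNormSq 4 u x ∂(sphMeasure 4)) +
      (-Real.log θ + 3 + Real.log M + n * p * (|Real.log (r / 2)| + 5)) := by
  have huc : Continuous u := hu.continuous
  have hn0 : (0 : ℝ) < n := by exact_mod_cast hn
  set A := ∫ x, Real.exp (3 * u x) ∂(sphMeasure 4) with hA
  have hA0 : 0 < A := by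
    have : NeZero (sphMeasure 4) := ⟨fun h => by
      have := sph_univ
      rw [h] at this
      simp at this⟩
    exact integral_exp_pos (exp_int huc)
  have hZp : ∀ i, 0 < tZ u (Ω i) := fun i => lt_of_lt_of_le (mul_pos hθ hA0) (hZ i)
  let ν : Fin n → Measure (E 4) := fun i => tnu u (Ω i)
  have hprob : ∀ i, IsProbabilityMeasure (ν i) := fun i => tnu_prob huc (hZp i)
  have hνS : ∀ i, ∀ᵐ y ∂(ν i), y ∈ sphere (0 : E 4) 1 := fun i => tnu_sph u (Ω i)
  let e : Fin n → ℝ := fun i => (tEnt u (Ω i) + Real.log M) / p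
  set B := ∑ i, Dη (r / 2) * |e i| * (2 * Real.pi ^ 2) with hB
  have hterm : ∀ i, 0 ≤ Dη (r / 2) * |e i| * (2 * Real.pi ^ 2) := fun i => by
    have := Dη_nonneg (r / 2); positivity
  have hB0 : 0 ≤ B := Finset.sum_nonneg fun i _ => hterm i
  obtain ⟨t0, ht0, happ⟩ := WK_approx huc
  obtain ⟨t, ht, ht2, htt0, htB⟩ : ∃ t : ℝ, 1 < t ∧ t ≤ 2 ∧ t ≤ t0 ∧ t ≤ 1 + 1 / (1 + B) := by
    refine ⟨min (min 2 t0) (1 + 1 / (1 + B)), ?_, ?_, ?_, min_le_right _ _⟩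
    · refine lt_min (lt_min (by norm_num) ht0) ?_
      have : 0 < 1 / (1 + B) := by positivity
      linarith
    · exact (min_le_left _ _).trans (min_le_left _ _)
    · exact (min_le_left _ _).trans (min_le_right _ _)
  have hsmall : ∀ i, (t - 1) * (Dη (r / 2) * |e i| * (2 * Real.pi ^ 2)) ≤ 1 := by
    intro i
    have h1 : Dη (r / 2) * |e i| * (2 * Real.pi ^ 2) ≤ B :=
      Finset.single_le_sum (f := fun i => Dη (r / 2) * |e i| * (2 * Real.pi ^ 2))
        (fun i _ => hterm i) (Finset.mem_univ i)
    calc _ ≤ (1 / (1 + B)) * (1 + B) := by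
          refine mul_le_mul (by linarith) (by linarith) (hterm i) (by positivity)
      _ = 1 := by field_simp
  have hk := kappa_bound hn ht ht2 ν hνS Ω (fun i => tnu_mem u (hΩ i)) hr hsep e
    (fun i x hx => Phi_tnu_le hp hM0 ht (hM t ht ht2) huc (hZp i) hx) hsmall
  have := avg_prob hn ν
  have havS : ∀ᵐ y ∂(avg ν), y ∈ sphere (0 : E 4) 1 :=
    (avg_ac ν (fun i => tnu_ac u (Ω i))).ae_le sph_ae
  obtain ⟨Cu, hCu⟩ := (isCompact_sphere (0 : E 4) 1).exists_bound_of_continuousOn huc.continuousOn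
  have hui : ∀ μ : Measure (E 4), IsFiniteMeasure μ → (∀ᵐ y ∂μ, y ∈ sphere (0 : E 4) 1) → Integrable u μ := by
    intro μ _ hμ
    refine Integrable.of_bound (C := Cu) huc.aestronglyMeasurable ?_
    filter_upwards [hμ] with y hy using hCu y hy
  have hl : 0 < 3 / (2 * n * p) := by positivity
  have hcap := cap ht ht2 hu hN (avg ν) havS hl
  set En := (∫ x in ball (0 : E 4) 1, (lap 4 u x) ^ 2) +
        2 * ∫ x, tgradNormSq 4 u x ∂(sphMeasure 4) with hEn
  set ub := (1 / (2 * Real.pi ^ 2)) * ∫ x, u x ∂(sphMeasure 4) with hub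
  set K := ∫ y, (∫ x, WK t y x * Phi t (avg ν) x ∂(sphMeasure 4)) ∂(avg ν) with hK
  set T := ∫ y, (∫ x, WK t y x * u x ∂(sphMeasure 4)) ∂(avg ν) with hT
  have hTu : (∫ y, u y ∂(avg ν)) - 1 ≤ T := by
    have h1 : ∫ y, (u y - 1) ∂(avg ν) ≤ T := by
      refine integral_mono_ae ((hui _ inferInstance havS).sub (integrable_const _))
        (WK_int ht (avg ν) havS huc.aestronglyMeasurable hCu) ?_
      filter_upwards [havS] with y hy
      have := abs_le.1 (happ t ht ht2 htt0 y hy)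
      linarith
    rw [integral_sub (hui _ inferInstance havS) (integrable_const _)] at h1
    simpa using h1
  have hau : ∫ y, u y ∂(avg ν) = (n : ℝ)⁻¹ * ∑ i, ∫ y, u y ∂(ν i) :=
    avg_integral ν fun i => hui _ inferInstance (hνS i)
  set Q := (n : ℝ)⁻¹ * ∑ i, tEnt u (Ω i) with hQ
  have hlogA : Real.log A ≤ -Real.log θ + 3 * (∫ y, u y ∂(avg ν)) - Q := by
    have h1 : ∀ i, Real.log A ≤ -Real.log θ + (3 * (∫ y, u y ∂(ν i)) - tEnt u (Ω i)) := by
      intro i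
      have h2 := Real.log_le_log (mul_pos hθ hA0) (hZ i)
      rw [Real.log_mul hθ.ne' hA0.ne'] at h2
      have h3 : tEnt u (Ω i) = 3 * (∫ x, u x ∂(ν i)) - Real.log (tZ u (Ω i)) := rfl
      linarith
    have h2 : ∑ _i : Fin n, Real.log A ≤
        ∑ i, (-Real.log θ + (3 * (∫ y, u y ∂(ν i)) - tEnt u (Ω i))) :=
      Finset.sum_le_sum fun i _ => h1 i
    have h3 := mul_le_mul_of_nonneg_left h2 (inv_nonneg.2 hn0.le)
    rw [Finset.sum_add_distrib, Finset.sum_sub_distrib, ← Finset.mul_sum] at h3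
    simp only [Finset.sum_const, Finset.card_univ, Fintype.card_fin, nsmul_eq_mul] at h3
    rw [mul_add, mul_sub, inv_mul_cancel_left₀ hn0.ne', inv_mul_cancel_left₀ hn0.ne'] at h3
    rw [hau]
    linarith
  have he' : (n : ℝ)⁻¹ * ∑ i, e i = (Q + Real.log M) / p := by
    simp only [e, hQ]
    rw [← Finset.sum_div, Finset.sum_add_distrib]
    simp
    field_simp
  rw [he'] at hk
  have hpi : 0 < Real.pi ^ 2 := by positivity
  -- scaled capacity inequality
  have h5 : 3 * (T - ub) ≤ 9 / (16 * Real.pi ^ 2 * n * p) * En + n * p * (K + 4) := by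
    have h6 := mul_le_mul_of_nonneg_left hcap (by positivity : 0 ≤ 3 / (8 * Real.pi ^ 2))
    have e1 : 3 / (8 * Real.pi ^ 2) * (8 * Real.pi ^ 2 * (T - ub)) = 3 * (T - ub) := by field_simp
    have e2 : 3 / (8 * Real.pi ^ 2) * (3 / (2 * n * p) * En +
        (3 / (2 * n * p))⁻¹ * (4 * Real.pi ^ 2 * (K + 4))) =
        9 / (16 * Real.pi ^ 2 * n * p) * En + n * p * (K + 4) := by field_simp; ring
    rw [e1, e2] at h6
    exact h6
  have h7 := mul_le_mul_of_nonneg_left hk (by positivity : 0 ≤ n * p)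
  have e3 : n * p * ((n : ℝ)⁻¹ * ((Q + Real.log M) / p) + (|Real.log (r / 2)| + 1)) =
      Q + Real.log M + n * p * (|Real.log (r / 2)| + 1) := by field_simp
  rw [e3] at h7
  linarith

/-! ### Part 11 : the concentration lemma -/

/-- evaluation of a polynomial at a point of `ℝ⁴`. -/
def ev (p : MvPolynomial (Fin 4) ℝ) (x : E 4) : ℝ := MvPolynomial.eval (fun i => x i) p

lemma ev_cont (p : MvPolynomial (Fin 4) ℝ) : Continuous (ev p) := by
  unfold ev
  exact (MvPolynomial.continuous_eval p).comp (by fun_prop)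

/-- `K` points suffice for a quadrature formula. -/
def IsQuad (m K : ℕ) : Prop := ∃ (x : Fin K → E 4) (w : Fin K → ℝ),
    (∀ i, x i ∈ Metric.sphere (0 : E 4) 1) ∧ (∀ i, 0 ≤ w i) ∧ (∑ i, w i) = 1 ∧
    ∀ p ∈ P0 4 m, (∑ i, w i * ev p (x i)) = 0

lemma quad_quant {m K : ℕ} (hK : ¬ IsQuad m K) :
    ∃ (ps : Finset (MvPolynomial (Fin 4) ℝ)) (c : ℝ), 0 < c ∧ (∀ p ∈ ps, p ∈ P0 4 m) ∧
      ∀ (x : Fin K → E 4) (w : Fin K → ℝ), (∀ i, x i ∈ sphere (0 : E 4) 1) → (∀ i, 0 ≤ w i) →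
        (∑ i, w i) = 1 → ∃ p ∈ ps, c ≤ |∑ i, w i * ev p (x i)| := by
  classical
  set C : Set ((Fin K → E 4) × (Fin K → ℝ)) :=
    (Set.pi Set.univ fun _ => sphere (0 : E 4) 1) ×ˢ stdSimplex ℝ (Fin K) with hC
  have hCc : IsCompact C :=
    (isCompact_univ_pi fun _ => isCompact_sphere _ _).prod (isCompact_stdSimplex _ _)
  let F : MvPolynomial (Fin 4) ℝ → ((Fin K → E 4) × (Fin K → ℝ)) → ℝ :=
    fun p q => ∑ i, q.2 i * ev p (q.1 i)
  have hF : ∀ p, Continuous (F p) := by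
    intro p
    have := ev_cont p
    fun_prop
  let U : (P0 4 m) × ℕ → Set ((Fin K → E 4) × (Fin K → ℝ)) :=
    fun k => {q | 1 / ((k.2 : ℝ) + 1) < |F k.1 q|}
  obtain ⟨s, hs⟩ := hCc.elim_finite_subcover U
    (fun k => isOpen_lt continuous_const (hF k.1).abs) (by
      intro q hq
      by_contra hcon
      refine hK ⟨q.1, q.2, fun i => hq.1 i (Set.mem_univ i), hq.2.1, hq.2.2, fun p hp => ?_⟩
      by_contra hne
      obtain ⟨k, hk⟩ := exists_nat_one_div_lt (abs_pos.2 hne)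
      exact hcon (Set.mem_iUnion.2 ⟨(⟨p, hp⟩, k), hk⟩))
  refine ⟨s.image (fun k => (k.1 : MvPolynomial (Fin 4) ℝ)), 1 / ((s.sup (fun k => k.2) : ℕ) + 1 : ℝ),
    by positivity, ?_, ?_⟩
  · intro p hp
    obtain ⟨k, _, rfl⟩ := Finset.mem_image.1 hp
    exact k.1.2
  · intro x w hx hw hw1
    have : (x, w) ∈ C := ⟨fun i _ => hx i, hw, hw1⟩
    obtain ⟨k, hk, hq⟩ := Set.mem_iUnion₂.1 (hs this)
    refine ⟨k.1, Finset.mem_image.2 ⟨k, hk, rfl⟩, ?_⟩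
    refine le_trans ?_ (le_of_lt hq)
    have : k.2 ≤ s.sup (fun k => k.2) := Finset.le_sup (f := fun k => k.2) hk
    have : (k.2 : ℝ) ≤ (s.sup (fun k => k.2) : ℕ) := by exact_mod_cast this
    exact one_div_le_one_div_of_le (by positivity) (by linarith)

/-- If most of the mass of `ν` is near `N+1` points, integrals are close to discrete sums. -/
lemma discretize (ν : Measure (E 4)) [IsProbabilityMeasure ν]
    (hν : ∀ᵐ y ∂ν, y ∈ sphere (0 : E 4) 1) {N : ℕ} (e : ℕ → E 4)
    (he : ∀ k, e k ∈ sphere (0 : E 4) 1) {ρ η a B : ℝ} (ha : 0 ≤ a) (hB : 0 ≤ B)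
    (hbad : ν.real {x | ∀ k ≤ N, ρ ≤ dist x (e k)} ≤ η) :
    ∃ w : Fin (N + 1) → ℝ, (∀ i, 0 ≤ w i) ∧ (∑ i, w i) = 1 ∧
      ∀ g : E 4 → ℝ, Continuous g → (∀ x ∈ sphere (0 : E 4) 1, |g x| ≤ B) →
        (∀ x ∈ sphere (0 : E 4) 1, ∀ y ∈ sphere (0 : E 4) 1, dist x y < ρ → |g x - g y| ≤ a) →
        |(∑ i, w i * g (e i)) - ∫ x, g x ∂ν| ≤ a + 2 * B * η := by
  let G : E 4 → Fin (N + 1) := fun x => ⟨SimpleFunc.nearestPtInd e N x,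
    Nat.lt_succ_of_le (SimpleFunc.nearestPtInd_le e N x)⟩
  have hG : Measurable G := by
    refine measurable_to_countable' fun k => ?_
    have : G ⁻¹' {k} = (SimpleFunc.nearestPtInd e N) ⁻¹' {(k : ℕ)} := by
      ext x
      simp [G, Fin.ext_iff]
    rw [this]
    exact SimpleFunc.measurableSet_fiber _ _
  have hGd : ∀ x, ∀ k ≤ N, dist (e (G x)) x ≤ dist (e k) x := by
    intro x k hk
    have := SimpleFunc.edist_nearestPt_le e x hk
    rw [edist_dist, edist_dist, ENNReal.ofReal_le_ofReal_iff dist_nonneg] at this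
    exact this
  have hsum : ∀ h : Fin (N + 1) → ℝ, ∑ i, ν.real (G ⁻¹' {i}) * h i = ∫ x, h (G x) ∂ν := by
    intro h
    have := Measure.isProbabilityMeasure_map (μ := ν) hG.aemeasurable
    rw [← integral_map (f := h) hG.aemeasurable (measurable_of_finite h).aestronglyMeasurable,
      integral_fintype (Integrable.of_finite)]
    refine Finset.sum_congr rfl fun i _ => ?_
    rw [measureReal_def, measureReal_def, Measure.map_apply hG (measurableSet_singleton i), smul_eq_mul]
  set bad : Set (E 4) := {x | ∀ k ≤ N, ρ ≤ dist x (e k)} with hbd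
  have hbm : MeasurableSet bad := by
    have : IsClosed bad := by
      have : bad = ⋂ k, ⋂ (_ : k ≤ N), {x | ρ ≤ dist x (e k)} := by ext x; simp [hbd]
      rw [this]
      exact isClosed_iInter fun k => isClosed_iInter fun _ =>
        isClosed_le continuous_const (continuous_id.dist continuous_const)
    exact this.measurableSet
  refine ⟨fun i => ν.real (G ⁻¹' {i}), fun i => measureReal_nonneg, ?_, ?_⟩
  · have := hsum fun _ => 1
    simpa using this
  · intro g hg hgB hga
    have h1 := hsum fun i => g (e i)
    rw [h1]
    have i1 : Integrable g ν := by
      refine Integrable.of_bound (C := B) hg.aestronglyMeasurable ?_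
      filter_upwards [hν] with x hx using hgB x hx
    have i2 : Integrable (fun x => g (e (G x))) ν := by
      refine Integrable.of_bound (C := B)
        ((measurable_of_finite (fun i : Fin (N + 1) => g (e i))).comp hG).aestronglyMeasurable ?_
      filter_upwards with x using hgB _ (he _)
    rw [← integral_sub i2 i1]
    have i3 : Integrable (fun x => a + bad.indicator (fun _ => 2 * B) x) ν :=
      (integrable_const a).add ((integrable_const (2 * B)).indicator hbm)
    calc |∫ x, (g (e (G x)) - g x) ∂ν| ≤ ∫ x, |g (e (G x)) - g x| ∂ν := abs_integral_le_integral_abs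
      _ ≤ ∫ x, (a + bad.indicator (fun _ => 2 * B) x) ∂ν := by
          refine integral_mono_ae (i2.sub i1).abs i3 ?_
          filter_upwards [hν] with x hx
          by_cases hxb : x ∈ bad
          · rw [Set.indicator_of_mem hxb]
            have h2 := abs_sub (g (e (G x))) (g x)
            have h3 := hgB _ (he (G x))
            have h4 := hgB x hx
            linarith
          · rw [Set.indicator_of_notMem hxb, add_zero]
            simp only [hbd, Set.mem_setOf_eq, not_forall, not_le] at hxb
            obtain ⟨k, hk, hd⟩ := hxb
            refine hga _ (he _) x hx ((hGd x k hk).trans_lt ?_)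
            rwa [dist_comm]
      _ = a + 2 * B * ν.real bad := by
          rw [integral_add (integrable_const a) ((integrable_const (2 * B)).indicator hbm),
            integral_indicator_const _ hbm]
          simp; ring
      _ ≤ _ := by gcongr

/-! ### Part 12 : separated heavy sets -/

/-- Either there are `K+1` separated heavy balls, or most of the mass lies near `K` points. -/
lemma dichotomy {r η : ℝ} (hr : 0 < r) (hη : 0 < η) :
    ∃ θ > (0 : ℝ), ∀ (ν : Measure (E 4)) [IsProbabilityMeasure ν],
      (∀ᵐ y ∂ν, y ∈ sphere (0 : E 4) 1) → ∀ N : ℕ,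
      (∃ z : Fin (N + 2) → E 4, (∀ i, θ ≤ ν.real (ball (z i) r)) ∧
          ∀ i j, i ≠ j → 3 * r ≤ dist (z i) (z j)) ∨
      (∃ e : ℕ → E 4, (∀ k, e k ∈ sphere (0 : E 4) 1) ∧
        ν.real {x | ∀ k ≤ N, 4 * r ≤ dist x (e k)} ≤ η) := by
  classical
  obtain ⟨F, hFS, hFfin, hFc⟩ := (isCompact_sphere (0 : E 4) 1).finite_cover_balls hr
  lift F to Finset (E 4) using hFfin
  have hθ : 0 < η / (F.card + 1) := by positivity
  refine ⟨η / (F.card + 1), hθ, ?_⟩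
  set θ := η / (F.card + 1) with hθd
  intro ν _ hν N
  have hx0 : (EuclideanSpace.single 0 1 : E 4) ∈ sphere (0 : E 4) 1 := by simp
  set H := F.filter (fun z => θ ≤ ν.real (ball z r)) with hH
  let sepF := H.powerset.filter (fun T => ∀ x ∈ T, ∀ y ∈ T, x ≠ y → 3 * r ≤ dist x y)
  obtain ⟨T, hTm, hTmax⟩ := sepF.exists_max_image Finset.card ⟨∅, by simp [sepF]⟩
  have hT := Finset.mem_filter.1 hTm
  have hTH : T ⊆ H := Finset.mem_powerset.1 hT.1
  have hTsep := hT.2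
  by_cases hcard : N + 2 ≤ T.card
  · left
    obtain ⟨T', hT', hc⟩ := Finset.exists_subset_card_eq hcard
    let eq := (T'.equivFinOfCardEq hc).symm
    refine ⟨fun i => eq i, fun i => ?_, fun i j hij => ?_⟩
    · exact (Finset.mem_filter.1 (hTH (hT' (eq i).2))).2
    · refine hTsep _ (hT' (eq i).2) _ (hT' (eq j).2) fun h => hij ?_
      exact eq.injective (Subtype.ext h)
  · right
    push Not at hcard
    let e : ℕ → E 4 := fun k => if h : k < T.card then (T.equivFin.symm ⟨k, h⟩ : E 4)
      else EuclideanSpace.single 0 1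
    have hTF : ∀ z ∈ T, z ∈ sphere (0 : E 4) 1 := fun z hz =>
      hFS (Finset.mem_filter.1 (hTH hz)).1
    have heT : ∀ z ∈ T, ∃ k ≤ N, e k = z := by
      intro z hz
      refine ⟨T.equivFin ⟨z, hz⟩, ?_, ?_⟩
      · have := (T.equivFin ⟨z, hz⟩).2
        omega
      · simp [e]
    refine ⟨e, fun k => ?_, ?_⟩
    · simp only [e]
      split_ifs with h
      · exact hTF _ (T.equivFin.symm ⟨k, h⟩).2
      · exact hx0
    · -- every heavy centre is within `3r` of `T`
      have hnear : ∀ h ∈ H, ∃ z ∈ T, dist h z < 3 * r := by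
        intro h hh
        by_contra hcon
        push Not at hcon
        have hhT : h ∉ T := fun hhT => by
          have := hcon h hhT
          rw [dist_self] at this
          linarith
        have hins : insert h T ∈ sepF := by
          refine Finset.mem_filter.2 ⟨Finset.mem_powerset.2 (Finset.insert_subset hh hTH), ?_⟩
          intro x hx y hy hxy
          rcases Finset.mem_insert.1 hx with hxh | hxT
          · rcases Finset.mem_insert.1 hy with hyh | hyT
            · exact absurd (hxh.trans hyh.symm) hxy
            · rw [hxh]; exact hcon y hyT
          · rcases Finset.mem_insert.1 hy with hyh | hyT
            · rw [dist_comm, hyh]; exact hcon x hxT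
            · exact hTsep x hxT y hyT hxy
        have := hTmax _ hins
        rw [Finset.card_insert_of_notMem hhT] at this
        omega
      set L := F.filter (fun z => ¬ θ ≤ ν.real (ball z r)) with hL
      have hsub : ∀ᵐ x ∂ν, x ∈ {x | ∀ k ≤ N, 4 * r ≤ dist x (e k)} → x ∈ ⋃ z ∈ L, ball z r := by
        filter_upwards [hν] with x hx hxb
        obtain ⟨z, hzF, hxz⟩ := Set.mem_iUnion₂.1 (hFc hx)
        by_cases hz : θ ≤ ν.real (ball z r)
        · exfalso
          obtain ⟨z', hz', hd⟩ := hnear z (Finset.mem_filter.2 ⟨hzF, hz⟩)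
          obtain ⟨k, hk, hke⟩ := heT z' hz'
          have h1 : 4 * r ≤ dist x (e k) := hxb k hk
          rw [hke] at h1
          have h2 := dist_triangle x z z'
          have h3 := mem_ball.1 hxz
          linarith
        · exact Set.mem_iUnion₂.2 ⟨z, Finset.mem_filter.2 ⟨hzF, hz⟩, hxz⟩
      calc ν.real {x | ∀ k ≤ N, 4 * r ≤ dist x (e k)} ≤ ν.real (⋃ z ∈ L, ball z r) := by
            rw [measureReal_def, measureReal_def]
            exact ENNReal.toReal_mono (measure_ne_top _ _) (measure_mono_ae hsub)
        _ ≤ ∑ z ∈ L, ν.real (ball z r) := measureReal_biUnion_finset_le _ _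
        _ ≤ ∑ z ∈ L, θ := Finset.sum_le_sum fun z hz => by
            have := (Finset.mem_filter.1 hz).2
            push Not at this
            exact this.le
        _ = L.card * θ := by simp
        _ ≤ (F.card + 1) * θ := by
            have : L.card ≤ F.card := Finset.card_filter_le _ _
            have : (L.card : ℝ) ≤ F.card := by exact_mod_cast this
            gcongr
            linarith
        _ = η := by rw [hθd]; field_simp

/-- **Concentration lemma.** -/
lemma concentration {m K : ℕ} (hK : ¬ IsQuad m K) :
    ∃ θ > (0 : ℝ), ∃ r > (0 : ℝ), ∀ (ν : Measure (E 4)) [IsProbabilityMeasure ν],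
      (∀ᵐ y ∂ν, y ∈ sphere (0 : E 4) 1) → (∀ p ∈ P0 4 m, ∫ x, ev p x ∂ν = 0) →
      ∃ Ω : Fin (K + 1) → Set (E 4), (∀ i, MeasurableSet (Ω i)) ∧ (∀ i, θ ≤ ν.real (Ω i)) ∧
        ∀ i j, i ≠ j → ∀ x ∈ Ω i, ∀ y ∈ Ω j, r ≤ ‖x - y‖ := by
  rcases K with _ | N
  · refine ⟨1, one_pos, 1, one_pos, fun ν _ _ _ => ⟨fun _ => Set.univ, fun _ => MeasurableSet.univ, fun _ => by simp, ?_⟩⟩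
    intro i j hij
    exact absurd (Subsingleton.elim (α := Fin 1) i j) hij
  obtain ⟨ps, c, hc, hps, hq⟩ := quad_quant hK
  obtain ⟨B, hB, hB1⟩ : ∃ B : ℝ, (∀ p ∈ ps, ∀ x ∈ sphere (0 : E 4) 1, |ev p x| ≤ B) ∧ 1 ≤ B := by
    have h : ∀ᶠ B : ℝ in atTop, ∀ p ∈ ps, ∀ x ∈ sphere (0 : E 4) 1, |ev p x| ≤ B := by
      refine (eventually_all_finset ps).2 fun p _ => ?_
      obtain ⟨C, hC⟩ := (isCompact_sphere (0 : E 4) 1).exists_bound_of_continuousOn (ev_cont p).continuousOn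
      filter_upwards [eventually_ge_atTop C] with B hB x hx
      exact (hC x hx).trans hB
    exact (h.and (eventually_ge_atTop 1)).exists
  obtain ⟨ρ, hρ, hρ0⟩ : ∃ ρ : ℝ, (∀ p ∈ ps, ∀ x ∈ sphere (0 : E 4) 1, ∀ y ∈ sphere (0 : E 4) 1,
      dist x y < ρ → |ev p x - ev p y| ≤ c / 4) ∧ 0 < ρ := by
    have h : ∀ᶠ ρ : ℝ in nhdsWithin 0 (Set.Ioi 0), ∀ p ∈ ps, ∀ x ∈ sphere (0 : E 4) 1,
        ∀ y ∈ sphere (0 : E 4) 1, dist x y < ρ → |ev p x - ev p y| ≤ c / 4 := by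
      refine (eventually_all_finset ps).2 fun p _ => ?_
      have huc := (isCompact_sphere (0 : E 4) 1).uniformContinuousOn_of_continuous (ev_cont p).continuousOn
      obtain ⟨δ, hδ, hd⟩ := Metric.uniformContinuousOn_iff.1 huc (c / 4) (by positivity)
      filter_upwards [Ioo_mem_nhdsGT hδ] with ρ hρ x hx y hy hxy
      have := hd x hx y hy (hxy.trans hρ.2)
      rw [Real.dist_eq] at this
      exact this.le
    exact (h.and self_mem_nhdsWithin).exists
  obtain ⟨θ, hθ, hdi⟩ := dichotomy (r := ρ / 4) (η := c / (8 * B)) (by positivity) (by positivity)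
  refine ⟨θ, hθ, ρ / 4, by positivity, fun ν _ hν hνp => ?_⟩
  rcases hdi ν hν N with ⟨z, hz, hzs⟩ | ⟨e, heS, hbad⟩
  · refine ⟨fun i => ball (z i) (ρ / 4), fun i => measurableSet_ball, hz, fun i j hij x hx y hy => ?_⟩
    have h1 := hzs i j hij
    have h2 := mem_ball.1 hx
    have h3 := mem_ball.1 hy
    have h4 := dist_triangle4 (z i) x y (z j)
    rw [dist_comm (z i) x] at h4
    rw [← dist_eq_norm]
    linarith
  · exfalso
    obtain ⟨w, hw0, hw1, hw⟩ := discretize ν hν e heS (a := c / 4) (B := B) (by positivity) (by positivity) hbad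
    obtain ⟨p, hp, hcp⟩ := hq (fun i => e i) w (fun i => heS i) hw0 hw1
    have h1 := hw (ev p) (ev_cont p) (hB p hp) (fun x hx y hy hxy => hρ p hp x hx y hy (by linarith))
    rw [hνp p (hps p hp), sub_zero] at h1
    have h2 : 2 * B * (c / (8 * B)) = c / 4 := by field_simp; norm_num
    linarith

/-! ### Part 13 : conclusion -/

lemma tnu_real {u : E 4 → ℝ} (hu : Continuous u) {Ω : Set (E 4)} (hΩ : MeasurableSet Ω) :
    (tnu u Set.univ).real Ω = tZ u Ω / tZ u Set.univ := by
  have h : (tnu u Set.univ).real Ω = ∫ x, Ω.indicator (fun _ => (1 : ℝ)) x ∂(tnu u Set.univ) := by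
    rw [integral_indicator_const _ hΩ]; simp
  rw [h, tnu_integral, setIntegral_univ]
  generalize tZ u Set.univ = Z
  rw [tZ, ← integral_div, ← integral_indicator hΩ]
  congr 1
  funext x
  by_cases hx : x ∈ Ω <;> simp [hx]

lemma main_K {m K : ℕ} (hK : ¬ IsQuad m K) {a : ℝ}
    (ha : 3 / (16 * Real.pi ^ 2 * ((K : ℝ) + 1)) < a) :
    ∃ C > (0 : ℝ), ∀ f u : E 4 → ℝ, ContDiff ℝ (⊤ : ℕ∞) f → ContDiff ℝ (⊤ : ℕ∞) u →
      (∀ p ∈ P0 4 m,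
        ∫ x, MvPolynomial.eval (fun i => x i) p * Real.exp (3 * f x) ∂(sphMeasure 4) = 0) →
      (∀ x ∈ Metric.sphere (0 : E 4) 1, u x = f x) →
      (∀ x ∈ Metric.sphere (0 : E 4) 1, fderiv ℝ u x x = 0) →
      Real.log ((1 / (2 * Real.pi ^ 2)) *
          ∫ x, Real.exp (3 * (f x - (1 / (2 * Real.pi ^ 2)) * ∫ y, f y ∂(sphMeasure 4)))
            ∂(sphMeasure 4)) ≤
        a * ((∫ x in Metric.ball (0 : E 4) 1, (lap 4 u x) ^ 2) +
              2 * ∫ x, tgradNormSq 4 f x ∂(sphMeasure 4)) + C := by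
  have hpi : 0 < 16 * Real.pi ^ 2 * ((K : ℝ) + 1) := by positivity
  have ha0 : 0 < a := lt_trans (by positivity) ha
  set p : ℝ := 9 / (16 * Real.pi ^ 2 * ((K : ℝ) + 1) * a) with hp
  have hp0 : 0 < p := by positivity
  have hp3 : p < 3 := by
    rw [div_lt_iff₀ hpi] at ha
    rw [hp, div_lt_iff₀ (by positivity)]
    linarith
  have hpa : 9 / (16 * Real.pi ^ 2 * ((K + 1 : ℕ) : ℝ) * p) = a := by
    rw [hp]; push_cast; field_simp
  obtain ⟨M, hM0, hM⟩ := sing_bound hp0 hp3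
  obtain ⟨θ, hθ, r, hr, hconc⟩ := concentration hK
  set C0 := -Real.log θ + 3 + Real.log M + ((K + 1 : ℕ) : ℝ) * p * (|Real.log (r / 2)| + 5) with hC0
  refine ⟨|C0| + 1, by positivity, ?_⟩
  intro f u hf hu hbal huf hN
  have hu2 : ContDiff ℝ 2 u := contDiff_infty.1 hu 2
  have huc : Continuous u := hu.continuous
  have hA0 : 0 < ∫ x, Real.exp (3 * u x) ∂(sphMeasure 4) := by
    have : NeZero (sphMeasure 4) := ⟨fun h => by
      have := sph_univ
      rw [h] at this
      simp at this⟩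
    exact integral_exp_pos (exp_int huc)
  have hZu : tZ u Set.univ = ∫ x, Real.exp (3 * u x) ∂(sphMeasure 4) := by
    rw [tZ, setIntegral_univ]
  have hZ0 : 0 < tZ u Set.univ := by rw [hZu]; exact hA0
  have := tnu_prob huc hZ0
  obtain ⟨Ω, hΩm, hΩθ, hΩs⟩ := hconc (tnu u Set.univ) (tnu_sph u Set.univ) (by
    intro q hq
    rw [tnu_integral, setIntegral_univ]
    have h1 : ∫ x, Real.exp (3 * u x) / tZ u Set.univ * ev q x ∂(sphMeasure 4) =
        ∫ x, (tZ u Set.univ)⁻¹ * (MvPolynomial.eval (fun i => x i) q * Real.exp (3 * f x)) ∂(sphMeasure 4) := by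
      refine integral_congr_ae ?_
      filter_upwards [sph_ae] with x hx
      rw [huf x hx, ev]
      ring
    rw [h1, integral_const_mul, hbal q hq, mul_zero])
  have hmain := assembly (Nat.succ_pos K) hp0 hM0 hM hθ hr hu2 hN Ω hΩm hΩs (by
    intro i
    have h1 := hΩθ i
    rw [tnu_real huc (hΩm i), le_div_iff₀ hZ0, hZu] at h1
    exact h1)
  rw [Nat.succ_eq_add_one, hpa, ← hC0] at hmain
  rw [tgrad_int_eq (hu2.differentiable (by norm_num)) (hf.differentiable (by simp)) huf]
  have e1 : ∫ y, f y ∂(sphMeasure 4) = ∫ y, u y ∂(sphMeasure 4) := by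
    refine integral_congr_ae ?_
    filter_upwards [sph_ae] with x hx using (huf x hx).symm
  rw [e1]
  set ub := (1 / (2 * Real.pi ^ 2)) * ∫ y, u y ∂(sphMeasure 4) with hub
  have e2 : ∫ x, Real.exp (3 * (f x - ub)) ∂(sphMeasure 4) =
      (∫ x, Real.exp (3 * u x) ∂(sphMeasure 4)) * Real.exp (-(3 * ub)) := by
    rw [← integral_mul_const]
    refine integral_congr_ae ?_
    filter_upwards [sph_ae] with x hx
    rw [← huf x hx, ← Real.exp_add]
    congr 1; ring
  rw [e2, Real.log_mul (by positivity) (by positivity), Real.log_mul hA0.ne' (Real.exp_pos _).ne',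
    Real.log_exp, one_div, Real.log_inv]
  have h2 : 0 ≤ Real.log (2 * Real.pi ^ 2) := by
    refine Real.log_nonneg ?_
    nlinarith [Real.pi_gt_three]
  have h3 := le_abs_self C0
  linarith

theorem stmt4 (m : ℕ) :
    ∀ ε > (0:ℝ), ∃ C > (0:ℝ), ∀ f u : E 4 → ℝ, ContDiff ℝ (⊤ : ℕ∞) f → ContDiff ℝ (⊤ : ℕ∞) u →
      (∀ p ∈ P0 4 m,
        ∫ x, MvPolynomial.eval (fun i => x i) p * Real.exp (3 * f x) ∂(sphMeasure 4) = 0) →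
      (∀ x ∈ Metric.sphere (0 : E 4) 1, u x = f x) →
      (∀ x ∈ Metric.sphere (0 : E 4) 1, fderiv ℝ u x x = 0) →
      Real.log ((1 / (2 * Real.pi ^ 2)) *
          ∫ x, Real.exp (3 * (f x - (1 / (2 * Real.pi ^ 2)) * ∫ y, f y ∂(sphMeasure 4)))
            ∂(sphMeasure 4)) ≤
        (3 / (16 * Real.pi ^ 2 * (Nsph 4 m : ℝ)) + ε) *
            ((∫ x in Metric.ball (0 : E 4) 1, (lap 4 u x) ^ 2) +
              2 * ∫ x, tgradNormSq 4 f x ∂(sphMeasure 4)) + C := by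
  intro ε hε
  by_cases hN : Nsph 4 m = 0
  · have hempty : ∀ K, ¬ IsQuad m K := by
      intro K hK
      rcases Nat.sInf_eq_zero.1 hN with h | h
      · obtain ⟨x, w, _, _, h1, _⟩ := h
        simp at h1
      · exact (Set.eq_empty_iff_forall_notMem.1 h K) hK
    obtain ⟨K, hK⟩ := exists_nat_one_div_lt hε
    rw [hN]
    have h0 : 3 / (16 * Real.pi ^ 2 * ((0 : ℕ) : ℝ)) + ε = ε := by simp
    rw [h0]
    refine main_K (hempty K) (lt_of_le_of_lt ?_ hK)
    rw [div_le_div_iff₀ (by positivity) (by positivity)]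
    have h1 : 3 ≤ 16 * Real.pi ^ 2 := by nlinarith [Real.pi_gt_three]
    have h2 : (0 : ℝ) ≤ (K : ℝ) + 1 := by positivity
    have h3 := mul_le_mul_of_nonneg_right h1 h2
    linarith
  · obtain ⟨K, hK⟩ := Nat.exists_eq_succ_of_ne_zero hN
    have hKn : ¬ IsQuad m K := by
      intro h
      have h1 : K < Nsph 4 m := by omega
      exact Nat.notMem_of_lt_sInf h1 h
    refine main_K hKn ?_
    rw [hK]
    push_cast
    linarith
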